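/- arXiv:math/0505546 — 6 statements merged into one kernel-verified Lean document; each statement's English description precedes it below -/
import Mathlib

section
/- Let R(z) = z(5 − 4z), so that R(0) = 0, R'(0) = 5, and for z₀ ∈ {3/4, 5/4} let ζ_{z₀,R}(s) := lim_{n→∞} Σ_{z ∈ R^{-n}{z₀}, z ≠ 0} (5ⁿ z)^{-s/2}, which converges for Re(s) > log 4 / log 5. Define, for Re(s) > log 9 / log 5, Z(s) := (1/2)·ζ_{3/4,R}(s)·( 1/(5^{s/2} − 3) + 3/(5^{s/2} − 1) ) + (1/2)·ζ_{5/4,R}(s)·( 3·5^{-s/2}/(5^{s/2} − 3) − 5^{-s/2}/(5^{s/2} − 1) ). Then Z extends to a meromorphic function on the half-plane {s : Re(s) > −1} which is holomorphic at every point of this half-plane not belonging to the set {2πik/log 5 : k ∈ ℤ} ∪ {(log 9 + 2πik)/log 5 : k ∈ ℤ}. (This function Z is the spectral zeta function of the Laplacian on the Sierpiński gasket.) -/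
open Polynomial Filter Complex

/-- The `n`-fold composition `R^{∘n}` of a polynomial, with `R^{∘0} = X`. -/
noncomputable def polyIter (R : Polynomial ℝ) : ℕ → Polynomial ℝ
  | 0 => Polynomial.X
  | n + 1 => R.comp (polyIter R n)

/-- The multiset `R^{-n}{z₀}` of complex roots (with multiplicity) of `R^{∘n}(z) - z₀`. -/
noncomputable def preimageRoots (R : Polynomial ℝ) (z₀ : ℝ) (n : ℕ) : Multiset ℂ :=
  ((polyIter R n - Polynomial.C z₀).map (algebraMap ℝ ℂ)).roots

/-- The partial sum `Σ_{z ∈ R^{-n}{z₀}, z ≠ 0} (cⁿ z)^{-s/2}`. -/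
noncomputable def zetaPartial (R : Polynomial ℝ) (c z₀ : ℝ) (n : ℕ) (s : ℂ) : ℂ :=
  ((preimageRoots R z₀ n).map
    (fun z => if z = 0 then 0 else ((c : ℂ) ^ n * z) ^ (-s / 2))).sum

/-- The polynomial `R(z) = z(5 − 4z)` of spectral decimation on the Sierpiński gasket. -/
noncomputable def gasketR : Polynomial ℝ :=
  Polynomial.X * (Polynomial.C 5 - Polynomial.C 4 * Polynomial.X)

/-- The square root `√(25 - 16 z)` of the discriminant of `R(w) = z`. -/
noncomputable def discSqrt (z : ℂ) : ℂ := (25 - 16 * z) ^ (((2 : ℕ) : ℂ)⁻¹)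

/-- The inverse branch of `gasketR` fixing `0`. -/
noncomputable def branchMinus (z : ℂ) : ℂ := (5 - discSqrt z) / 8

/-- The inverse branch of `gasketR` sending `0` to `5 / 4`. -/
noncomputable def branchPlus (z : ℂ) : ℂ := (5 + discSqrt z) / 8

/-- Composition with `branchMinus`. -/
noncomputable def pullMinus : Module.End ℂ (ℂ → ℂ) := LinearMap.funLeft ℂ ℂ branchMinus

/-- Composition with `branchPlus`. -/
noncomputable def pullPlus : Module.End ℂ (ℂ → ℂ) := LinearMap.funLeft ℂ ℂ branchPlus

/-- The transfer operator `φ ↦ (z ↦ ∑_{R(w) = z} φ(w))`. -/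
noncomputable def transfer : Module.End ℂ (ℂ → ℂ) := pullMinus + pullPlus

lemma discSqrt_sq (z : ℂ) : discSqrt z ^ 2 = 25 - 16 * z :=
  Complex.cpow_nat_inv_pow _ two_ne_zero

lemma transfer_apply (φ : ℂ → ℂ) (z : ℂ) :
    transfer φ z = φ (branchMinus z) + φ (branchPlus z) := rfl

lemma transfer_pow_succ_apply (n : ℕ) (φ : ℂ → ℂ) (z : ℂ) :
    (transfer ^ (n + 1)) φ z =
      (transfer ^ n) φ (branchMinus z) + (transfer ^ n) φ (branchPlus z) := by
  rw [pow_succ']; rfl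

lemma pullMinus_pow_apply (n : ℕ) (φ : ℂ → ℂ) (z : ℂ) :
    (pullMinus ^ n) φ z = φ (branchMinus^[n] z) := by
  induction n generalizing z with
  | zero => rfl
  | succ n ih =>
    rw [pow_succ', Function.iterate_succ_apply, ← ih]
    rfl

lemma polyIter_map_sub (n : ℕ) (z : ℂ) :
    (polyIter gasketR (n + 1)).map (algebraMap ℝ ℂ) - Polynomial.C z =
      Polynomial.C (-4) *
        (((polyIter gasketR n).map (algebraMap ℝ ℂ) - Polynomial.C (branchMinus z)) *
        ((polyIter gasketR n).map (algebraMap ℝ ℂ) - Polynomial.C (branchPlus z))) := by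
  have h1 : branchMinus z + branchPlus z = 5 / 4 := by
    unfold branchMinus branchPlus; ring
  have h2 : branchMinus z * branchPlus z = z / 4 := by
    have := discSqrt_sq z
    unfold branchMinus branchPlus; linear_combination (-1 / 64) * this
  have e5 : (Polynomial.C (5 : ℂ)) =
      Polynomial.C 4 * (Polynomial.C (branchMinus z) + Polynomial.C (branchPlus z)) := by
    rw [← Polynomial.C_add, h1, ← Polynomial.C_mul]; norm_num
  have ez : (Polynomial.C z) =
      Polynomial.C 4 * (Polynomial.C (branchMinus z) * Polynomial.C (branchPlus z)) := by
    rw [← Polynomial.C_mul, h2, ← Polynomial.C_mul]; congr 1; ring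
  have key : (polyIter gasketR (n + 1)).map (algebraMap ℝ ℂ) =
      (polyIter gasketR n).map (algebraMap ℝ ℂ) *
        (Polynomial.C 5 - Polynomial.C 4 * (polyIter gasketR n).map (algebraMap ℝ ℂ)) := by
    simp [polyIter, gasketR]
  rw [key, e5, ez, Polynomial.C_neg]
  ring

lemma polyIter_map_sub_ne_zero (n : ℕ) (z : ℂ) :
    (polyIter gasketR n).map (algebraMap ℝ ℂ) - Polynomial.C z ≠ 0 := by
  induction n generalizing z with
  | zero => simpa [polyIter] using Polynomial.X_sub_C_ne_zero z
  | succ n ih =>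
    rw [polyIter_map_sub]
    exact mul_ne_zero (Polynomial.C_ne_zero.2 (by norm_num)) (mul_ne_zero (ih _) (ih _))

lemma sum_roots_eq_transfer_pow (n : ℕ) (φ : ℂ → ℂ) (z : ℂ) :
    ((((polyIter gasketR n).map (algebraMap ℝ ℂ) - Polynomial.C z).roots).map φ).sum =
      (transfer ^ n) φ z := by
  induction n generalizing z with
  | zero => simp [polyIter]
  | succ n ih =>
    rw [polyIter_map_sub, Polynomial.roots_C_mul _ (by norm_num), Polynomial.roots_mul
      (mul_ne_zero (polyIter_map_sub_ne_zero _ _) (polyIter_map_sub_ne_zero _ _)),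
      Multiset.map_add, Multiset.sum_add, ih, ih, transfer_pow_succ_apply]

lemma zetaPartial_eq_transfer_pow (z₀ : ℝ) (n : ℕ) (s : ℂ) :
    zetaPartial gasketR 5 z₀ n s =
      (transfer ^ n) (fun z => if z = 0 then 0 else (5 ^ n * z) ^ (-s / 2)) z₀ := by
  rw [← sum_roots_eq_transfer_pow]
  simp [zetaPartial, preimageRoots]

/-- Grouping the words in the two branches by the position of the last `branchPlus`. -/
lemma transfer_pow_eq (n : ℕ) :
    transfer ^ n = pullMinus ^ n +
      ∑ j ∈ Finset.range n, transfer ^ j * (pullPlus * pullMinus ^ (n - 1 - j)) := by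
  induction n with
  | zero => simp
  | succ n ih =>
    have h : transfer ^ (n + 1) = transfer ^ n * pullMinus + transfer ^ n * pullPlus := by
      rw [pow_succ, ← mul_add]; rfl
    rw [h, Finset.sum_range_succ, ← add_assoc]
    congr 1
    · rw [ih, add_mul, ← pow_succ, Finset.sum_mul]
      congr 1
      refine Finset.sum_congr rfl fun j hj => ?_
      have : n + 1 - 1 - j = (n - 1 - j) + 1 := by
        have := Finset.mem_range.1 hj
        omega
      rw [this, pow_succ, mul_assoc, mul_assoc]
    · simp

/-- The interval `(0, 5/4]`, inside `ℂ`. -/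
def gasketInterval : Set ℂ := {z | ∃ x : ℝ, 0 < x ∧ x ≤ 5 / 4 ∧ z = x}

lemma discSqrt_ofReal {x : ℝ} (hx : x ≤ 5 / 4) :
    discSqrt x = (Real.sqrt (25 - 16 * x) : ℝ) := by
  rw [Real.sqrt_eq_rpow, Complex.ofReal_cpow (by linarith)]
  simp [discSqrt]

lemma branch_mem {z : ℂ} (hz : z ∈ gasketInterval) :
    branchMinus z ∈ gasketInterval ∧ branchPlus z ∈ gasketInterval := by
  obtain ⟨x, h0, h1, rfl⟩ := hz
  have hs0 := Real.sqrt_nonneg (25 - 16 * x)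
  have hs : Real.sqrt (25 - 16 * x) < 5 := by
    rw [Real.sqrt_lt' (by norm_num)]; linarith
  refine ⟨⟨(5 - Real.sqrt (25 - 16 * x)) / 8, by linarith, by linarith, ?_⟩,
    ⟨(5 + Real.sqrt (25 - 16 * x)) / 8, by linarith, by linarith, ?_⟩⟩
  · simp [branchMinus, discSqrt_ofReal h1]
  · simp [branchPlus, discSqrt_ofReal h1]

lemma branchMinus_iterate_mem {z : ℂ} (hz : z ∈ gasketInterval) (n : ℕ) :
    branchMinus^[n] z ∈ gasketInterval := by
  induction n with
  | zero => exact hz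
  | succ n ih => rw [Function.iterate_succ_apply']; exact (branch_mem ih).1

lemma transfer_pow_congr {φ ψ : ℂ → ℂ} (h : ∀ z ∈ gasketInterval, φ z = ψ z) (n : ℕ) :
    ∀ z ∈ gasketInterval, (transfer ^ n) φ z = (transfer ^ n) ψ z := by
  induction n with
  | zero => simpa using h
  | succ n ih =>
    intro z hz
    rw [transfer_pow_succ_apply, transfer_pow_succ_apply, ih _ (branch_mem hz).1,
      ih _ (branch_mem hz).2]

lemma norm_transfer_pow_le {φ : ℂ → ℂ} {M : ℝ} (h : ∀ z ∈ gasketInterval, ‖φ z‖ ≤ M) (n : ℕ) :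
    ∀ z ∈ gasketInterval, ‖(transfer ^ n) φ z‖ ≤ 2 ^ n * M := by
  induction n with
  | zero => simpa using h
  | succ n ih =>
    intro z hz
    rw [transfer_pow_succ_apply]
    refine (norm_add_le _ _).trans ?_
    have h1 := ih _ (branch_mem hz).1
    have h2 := ih _ (branch_mem hz).2
    rw [pow_succ]
    linarith

lemma tendsto_transfer_pow {φ : ℕ → ℂ → ℂ} {ψ : ℂ → ℂ}
    (h : ∀ z ∈ gasketInterval, Tendsto (fun m => φ m z) atTop (nhds (ψ z))) (n : ℕ) :
    ∀ z ∈ gasketInterval,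
      Tendsto (fun m => (transfer ^ n) (φ m) z) atTop (nhds ((transfer ^ n) ψ z)) := by
  induction n with
  | zero => simpa using h
  | succ n ih =>
    intro z hz
    simp only [transfer_pow_succ_apply]
    exact (ih _ (branch_mem hz).1).add (ih _ (branch_mem hz).2)

lemma hasSum_transfer_pow {φ : ℕ → ℂ → ℂ} {ψ : ℂ → ℂ}
    (h : ∀ z ∈ gasketInterval, HasSum (fun m => φ m z) (ψ z)) (n : ℕ) :
    ∀ z ∈ gasketInterval, HasSum (fun m => (transfer ^ n) (φ m) z) ((transfer ^ n) ψ z) := by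
  induction n with
  | zero => simpa using h
  | succ n ih =>
    intro z hz
    simp only [transfer_pow_succ_apply]
    exact (ih _ (branch_mem hz).1).add (ih _ (branch_mem hz).2)

lemma differentiable_transfer_pow {φ : ℂ → ℂ → ℂ} (h : ∀ z, Differentiable ℂ fun s => φ s z)
    (n : ℕ) : ∀ z, Differentiable ℂ fun s => (transfer ^ n) (φ s) z := by
  induction n with
  | zero => simpa using h
  | succ n ih =>
    intro z
    simp only [transfer_pow_succ_apply]
    exact (ih _).add (ih _)

/-- The monomial `(z - 5/8) ^ k`, centred at the critical point of `gasketR`. -/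
noncomputable def centredPow (k : ℕ) (z : ℂ) : ℂ := (z - 5 / 8) ^ k

lemma transfer_centredPow_odd (j : ℕ) : transfer (centredPow (2 * j + 1)) = 0 := by
  funext z
  have h : branchMinus z - 5 / 8 = -(branchPlus z - 5 / 8) := by
    unfold branchMinus branchPlus; ring
  rw [transfer_apply, centredPow, centredPow, h, Odd.neg_pow ⟨j, rfl⟩]
  simp

lemma transfer_centredPow_even (j : ℕ) :
    transfer (centredPow (2 * j)) = ∑ i ∈ Finset.range (j + 1),
      (2 * ((-1 / 4) ^ i * (15 / 64) ^ (j - i) * (j.choose i : ℂ))) • centredPow i := by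
  funext z
  have h1 : (branchMinus z - 5 / 8) ^ 2 = -1 / 4 * (z - 5 / 8) + 15 / 64 := by
    unfold branchMinus; linear_combination (1 / 64) * discSqrt_sq z
  have h2 : (branchPlus z - 5 / 8) ^ 2 = -1 / 4 * (z - 5 / 8) + 15 / 64 := by
    unfold branchPlus; linear_combination (1 / 64) * discSqrt_sq z
  rw [transfer_apply, centredPow, centredPow, pow_mul, pow_mul, h1, h2, ← two_mul, add_pow,
    Finset.sum_apply, Finset.mul_sum]
  refine Finset.sum_congr rfl fun i _ => ?_
  simp only [Pi.smul_apply, smul_eq_mul, centredPow, mul_pow]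
  ring

lemma norm_sub_le_of_mem {z : ℂ} (hz : z ∈ gasketInterval) : ‖z - 5 / 8‖ ≤ 5 / 8 := by
  obtain ⟨x, h0, h1, rfl⟩ := hz
  have : ((x : ℂ) - 5 / 8) = ((x - 5 / 8 : ℝ) : ℂ) := by push_cast; rfl
  rw [this, Complex.norm_real, Real.norm_eq_abs, abs_le]
  constructor <;> linarith

lemma norm_centredPow_sub_le {z w : ℂ} (hz : z ∈ gasketInterval) (hw : w ∈ gasketInterval)
    (k : ℕ) : ‖centredPow k z - centredPow k w‖ ≤ 2 * (5 / 8) ^ k := by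
  refine (norm_sub_le _ _).trans ?_
  rw [centredPow, centredPow, norm_pow, norm_pow]
  have h1 := pow_le_pow_left₀ (norm_nonneg _) (norm_sub_le_of_mem hz) k
  have h2 := pow_le_pow_left₀ (norm_nonneg _) (norm_sub_le_of_mem hw) k
  linarith

lemma transfer_pow_centredPow_zero_sub (n : ℕ) (z w : ℂ) :
    (transfer ^ n) (centredPow 0) z - (transfer ^ n) (centredPow 0) w = 0 := by
  have h : ∀ z, (transfer ^ n) (centredPow 0) z = 2 ^ n := by
    induction n with
    | zero => simp [centredPow]
    | succ n ih => intro z; rw [transfer_pow_succ_apply, ih, ih, pow_succ]; ring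
  rw [h, h, sub_self]

lemma norm_transfer_pow_succ_centredPow_le {n : ℕ} {K : ℝ} {z w : ℂ}
    (h : ∀ i, ‖(transfer ^ n) (centredPow i) z - (transfer ^ n) (centredPow i) w‖ ≤ K * 2 ^ i)
    (j : ℕ) :
    ‖(transfer ^ (n + 1)) (centredPow (2 * j)) z - (transfer ^ (n + 1)) (centredPow (2 * j)) w‖ ≤
      2 * K * ((47 / 64) ^ j - (15 / 64) ^ j) := by
  have hs : (transfer ^ (n + 1)) (centredPow (2 * j)) =
      ∑ i ∈ Finset.range (j + 1), (2 * ((-1 / 4) ^ i * (15 / 64) ^ (j - i) * (j.choose i : ℂ))) •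
        (transfer ^ n) (centredPow i) := by
    rw [pow_succ, Module.End.mul_apply, transfer_centredPow_even, map_sum]
    simp only [map_smul]
  have hb : ((47 / 64 : ℝ)) ^ j - (15 / 64) ^ j =
      ∑ i ∈ Finset.range j, (1 / 2) ^ (i + 1) * (15 / 64) ^ (j - (i + 1)) *
        (j.choose (i + 1) : ℝ) := by
    rw [show (47 / 64 : ℝ) = 1 / 2 + 15 / 64 by norm_num, add_pow, Finset.sum_range_succ']
    simp
  rw [hs, Finset.sum_apply, Finset.sum_apply, ← Finset.sum_sub_distrib, Finset.sum_range_succ', hb,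
    Finset.mul_sum]
  simp only [Pi.smul_apply, smul_eq_mul, ← mul_sub, transfer_pow_centredPow_zero_sub, mul_zero,
    add_zero]
  refine (norm_sum_le _ _).trans (Finset.sum_le_sum fun i _ => ?_)
  simp only [norm_mul, norm_pow, norm_div, norm_neg, norm_one, Complex.norm_ofNat,
    Complex.norm_natCast]
  refine (mul_le_mul_of_nonneg_left (h (i + 1)) (by positivity)).trans (le_of_eq ?_)
  have : ((1 : ℝ) / 2) ^ (i + 1) = (1 / 4) ^ (i + 1) * 2 ^ (i + 1) := by
    rw [← mul_pow]; norm_num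
  rw [this]; ring

lemma norm_transfer_pow_centredPow_sub_le (n : ℕ) (k : ℕ) {z w : ℂ}
    (hz : z ∈ gasketInterval) (hw : w ∈ gasketInterval) :
    ‖(transfer ^ n) (centredPow k) z - (transfer ^ n) (centredPow k) w‖ ≤
      2 * (1 / 4) ^ n * 2 ^ k := by
  induction n generalizing k with
  | zero =>
    refine (norm_centredPow_sub_le hz hw k).trans ?_
    have : ((5 : ℝ) / 8) ^ k ≤ 2 ^ k := pow_le_pow_left₀ (by norm_num) (by norm_num) k
    simpa using this
  | succ n ih =>
    rcases Nat.even_or_odd' k with ⟨j, rfl | rfl⟩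
    · refine (norm_transfer_pow_succ_centredPow_le ih j).trans ?_
      have hj : 8 * ((47 / 64 : ℝ) ^ j - (15 / 64) ^ j) ≤ 4 ^ j := by
        rcases j with _ | _ | j
        · norm_num
        · norm_num
        · have h1 : (47 / 64 : ℝ) ^ j ≤ 4 ^ j := pow_le_pow_left₀ (by norm_num) (by norm_num) j
          have h2 : 0 ≤ (15 / 64 : ℝ) ^ j := by positivity
          have h3 : (0 : ℝ) ≤ 4 ^ j := by positivity
          simp only [pow_succ]
          nlinarith
      have h4 : (2 : ℝ) ^ (2 * j) = 4 ^ j := by rw [pow_mul]; norm_num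
      rw [h4, pow_succ]
      have h5 : (0 : ℝ) < (1 / 4) ^ n := by positivity
      nlinarith
    · rw [pow_succ, Module.End.mul_apply, transfer_centredPow_odd]
      simp only [map_zero, Pi.zero_apply, sub_zero, norm_zero]
      positivity

lemma norm_transfer_pow_centredPow_sub_le' (n : ℕ) (k : ℕ) {z w : ℂ}
    (hz : z ∈ gasketInterval) (hw : w ∈ gasketInterval) :
    ‖(transfer ^ n) (centredPow k) z - (transfer ^ n) (centredPow k) w‖ ≤
      16 * (1 / 4) ^ n * (7 / 8) ^ k := by
  rcases n with _ | n
  · refine (norm_centredPow_sub_le hz hw k).trans ?_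
    have h : ((5 : ℝ) / 8) ^ k ≤ (7 / 8) ^ k := pow_le_pow_left₀ (by norm_num) (by norm_num) k
    have h0 : 0 ≤ ((7 : ℝ) / 8) ^ k := by positivity
    simp only [pow_zero, mul_one]
    linarith
  rcases Nat.even_or_odd' k with ⟨j, rfl | rfl⟩
  · refine (norm_transfer_pow_succ_centredPow_le
      (fun i => norm_transfer_pow_centredPow_sub_le n i hz hw) j).trans ?_
    have h1 : (47 / 64 : ℝ) ^ j ≤ (49 / 64) ^ j := pow_le_pow_left₀ (by norm_num) (by norm_num) j
    have h2 : 0 ≤ (15 / 64 : ℝ) ^ j := by positivity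
    have h4 : (7 / 8 : ℝ) ^ (2 * j) = (49 / 64) ^ j := by rw [pow_mul]; norm_num
    rw [h4, pow_succ]
    have h5 : (0 : ℝ) < (1 / 4) ^ n := by positivity
    nlinarith
  · rw [pow_succ, Module.End.mul_apply, transfer_centredPow_odd]
    simp only [map_zero, Pi.zero_apply, sub_zero, norm_zero]
    positivity

lemma discSqrt_re_nonneg (z : ℂ) : 0 ≤ (discSqrt z).re := by
  rcases eq_or_ne (25 - 16 * z) 0 with h | h
  · simp [discSqrt, h]
  · have h1 := Complex.neg_pi_lt_arg (25 - 16 * z)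
    have h2 := Complex.arg_le_pi (25 - 16 * z)
    have h3 : Complex.log (25 - 16 * z) * (((2 : ℕ) : ℂ)⁻¹) =
        ((2⁻¹ : ℝ) : ℂ) * Complex.log (25 - 16 * z) := by
      push_cast; ring
    rw [discSqrt, Complex.cpow_def_of_ne_zero h, h3, Complex.exp_re, Complex.im_ofReal_mul,
      Complex.log_im]
    refine mul_nonneg (Real.exp_pos _).le (Real.cos_nonneg_of_neg_pi_div_two_le_of_le ?_ ?_) <;>
      linarith

lemma five_le_norm (z : ℂ) : 5 ≤ ‖5 + discSqrt z‖ := by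
  refine le_trans ?_ (Complex.re_le_norm _)
  have := discSqrt_re_nonneg z
  simpa using this

lemma five_add_discSqrt_ne_zero (z : ℂ) : 5 + discSqrt z ≠ 0 := by
  intro h
  have := five_le_norm z
  rw [h, norm_zero] at this
  linarith

lemma differentiableAt_discSqrt {z : ℂ} (hz : 0 < (25 - 16 * z).re) :
    DifferentiableAt ℂ discSqrt z := by
  unfold discSqrt
  exact DifferentiableAt.cpow_const (by fun_prop) (Or.inl hz)

lemma re_pos_of_norm_lt {z : ℂ} (hz : ‖z‖ < 3 / 2) : 0 < (25 - 16 * z).re := by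
  have := Complex.re_le_norm z
  simp
  linarith

lemma norm_branchMinus_le (z : ℂ) : ‖branchMinus z‖ ≤ 2 / 5 * ‖z‖ := by
  have h : branchMinus z * (5 + discSqrt z) = 2 * z := by
    unfold branchMinus; linear_combination (-1 / 8) * discSqrt_sq z
  have h' : ‖branchMinus z‖ * ‖5 + discSqrt z‖ = 2 * ‖z‖ := by
    rw [← norm_mul, h, norm_mul, Complex.norm_ofNat]
  nlinarith [five_le_norm z, norm_nonneg (branchMinus z)]

lemma norm_branchMinus_iterate_le (k : ℕ) (z : ℂ) :
    ‖branchMinus^[k] z‖ ≤ (2 / 5) ^ k * ‖z‖ := by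
  induction k with
  | zero => simp
  | succ k ih =>
    rw [Function.iterate_succ_apply', pow_succ]
    have := norm_branchMinus_le (branchMinus^[k] z)
    linarith

/-- The factor `5 * branchMinus z / z`, extended analytically to `z = 0`. -/
noncomputable def branchRatio (z : ℂ) : ℂ := 10 / (5 + discSqrt z)

lemma five_mul_branchMinus (z : ℂ) : 5 * branchMinus z = z * branchRatio z := by
  have h := five_add_discSqrt_ne_zero z
  unfold branchRatio branchMinus
  field_simp
  linear_combination (-5) * discSqrt_sq z

lemma norm_branchRatio_sub_one_le (z : ℂ) : ‖branchRatio z - 1‖ ≤ 16 / 25 * ‖z‖ := by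
  have h := five_add_discSqrt_ne_zero z
  have h1 : branchRatio z - 1 = 16 * z / (5 + discSqrt z) ^ 2 := by
    unfold branchRatio
    field_simp
    linear_combination (-1) * discSqrt_sq z
  rw [h1, norm_div, norm_mul, norm_pow, Complex.norm_ofNat, div_le_iff₀ (by positivity)]
  nlinarith [pow_le_pow_left₀ (by norm_num) (five_le_norm z) 2, norm_nonneg z]

lemma branchRatio_mem_slitPlane {z : ℂ} (hz : ‖z‖ < 3 / 2) :
    branchRatio z ∈ Complex.slitPlane := by
  have h : ‖branchRatio z - 1‖ < 1 := by
    have := norm_branchRatio_sub_one_le z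
    linarith
  simpa using Complex.mem_slitPlane_of_norm_lt_one h

lemma norm_log_branchRatio_le {z : ℂ} (hz : ‖z‖ < 3 / 2) :
    ‖Complex.log (branchRatio z)‖ ≤ 26 / 3 * ‖z‖ := by
  have h0 := norm_branchRatio_sub_one_le z
  have h1 : ‖branchRatio z - 1‖ ≤ 24 / 25 := by linarith
  have h := Complex.norm_log_one_add_le (z := branchRatio z - 1) (by linarith)
  rw [add_sub_cancel] at h
  refine h.trans ?_
  have h2 : (1 - ‖branchRatio z - 1‖)⁻¹ ≤ 25 := by
    rw [inv_le_comm₀ (by linarith) (by norm_num)]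
    linarith
  have h3 : ‖branchRatio z - 1‖ ^ 2 * (1 - ‖branchRatio z - 1‖)⁻¹ ≤
      (24 / 25 * ‖branchRatio z - 1‖) * 25 := by
    refine mul_le_mul ?_ h2 (inv_nonneg.2 (by linarith)) (by positivity)
    nlinarith [norm_nonneg (branchRatio z - 1)]
  linarith [norm_nonneg z]

lemma norm_branchMinus_iterate_lt {z : ℂ} (hz : ‖z‖ < 3 / 2) (k : ℕ) :
    ‖branchMinus^[k] z‖ < 3 / 2 := by
  refine (norm_branchMinus_iterate_le k z).trans_lt (lt_of_le_of_lt ?_ hz)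
  exact mul_le_of_le_one_left (norm_nonneg _) (pow_le_one₀ (by norm_num) (by norm_num))

lemma norm_log_branchRatio_iterate_le {z : ℂ} (hz : ‖z‖ < 3 / 2) (k : ℕ) :
    ‖Complex.log (branchRatio (branchMinus^[k] z))‖ ≤ 13 * (2 / 5) ^ k := by
  refine (norm_log_branchRatio_le (norm_branchMinus_iterate_lt hz k)).trans ?_
  have h1 := norm_branchMinus_iterate_le k z
  have h2 : (2 / 5 : ℝ) ^ k * ‖z‖ ≤ (2 / 5) ^ k * (3 / 2) := by gcongr
  linarith

lemma summable_majorant : Summable fun k : ℕ => 13 * (2 / 5 : ℝ) ^ k :=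
  (summable_geometric_of_lt_one (by norm_num) (by norm_num)).mul_left 13

lemma sum_majorant_le (n : ℕ) : ∑ k ∈ Finset.range n, 13 * (2 / 5 : ℝ) ^ k ≤ 22 := by
  refine (summable_majorant.sum_le_tsum _ fun k _ => by positivity).trans ?_
  rw [tsum_mul_left, tsum_geometric_of_lt_one (by norm_num) (by norm_num)]
  norm_num

lemma differentiableOn_branchMinus_iterate (k : ℕ) :
    DifferentiableOn ℂ (branchMinus^[k]) (Metric.ball 0 (3 / 2)) := by
  refine DifferentiableOn.iterate (fun z hz => ?_) (fun z hz => ?_) k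
  · have := differentiableAt_discSqrt (re_pos_of_norm_lt (mem_ball_zero_iff.1 hz))
    refine DifferentiableAt.differentiableWithinAt ?_
    unfold branchMinus
    fun_prop
  · rw [mem_ball_zero_iff] at hz ⊢
    have := norm_branchMinus_le z
    have := norm_nonneg z
    linarith

lemma differentiableOn_log_branchRatio_iterate (k : ℕ) :
    DifferentiableOn ℂ (fun z => Complex.log (branchRatio (branchMinus^[k] z)))
      (Metric.ball 0 (3 / 2)) := by
  intro z hz
  have hk := norm_branchMinus_iterate_lt (mem_ball_zero_iff.1 hz) k
  have h1 : DifferentiableAt ℂ branchRatio (branchMinus^[k] z) := by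
    have := differentiableAt_discSqrt (re_pos_of_norm_lt hk)
    unfold branchRatio
    exact (differentiableAt_const _).div (by fun_prop) (five_add_discSqrt_ne_zero _)
  exact (h1.comp_differentiableWithinAt z
    (differentiableOn_branchMinus_iterate k z hz)).clog (branchRatio_mem_slitPlane hk)

/-- The logarithm of `5 ^ m * branchMinus^[m] z`. -/
noncomputable def logApprox (m : ℕ) (z : ℂ) : ℂ :=
  Complex.log z + ∑ k ∈ Finset.range m, Complex.log (branchRatio (branchMinus^[k] z))

/-- The logarithm of the Koenigs linearizer of `gasketR` at `0`. -/
noncomputable def logKoenigs (z : ℂ) : ℂ :=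
  Complex.log z + ∑' k, Complex.log (branchRatio (branchMinus^[k] z))

lemma norm_lt_of_mem {z : ℂ} (hz : z ∈ gasketInterval) : ‖z‖ < 3 / 2 := by
  obtain ⟨x, h0, h1, rfl⟩ := hz
  rw [Complex.norm_real, Real.norm_eq_abs, abs_of_pos h0]
  linarith

lemma tendsto_logApprox {z : ℂ} (hz : ‖z‖ < 3 / 2) :
    Tendsto (fun m => logApprox m z) atTop (nhds (logKoenigs z)) := by
  have h : Summable fun k => Complex.log (branchRatio (branchMinus^[k] z)) :=
    Summable.of_norm_bounded summable_majorant (norm_log_branchRatio_iterate_le hz)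
  exact h.hasSum.tendsto_sum_nat.const_add _

lemma norm_logApprox_le {z : ℂ} (hz : ‖z‖ < 3 / 2) (m : ℕ) :
    ‖logApprox m z‖ ≤ ‖Complex.log z‖ + 22 := by
  refine (norm_add_le _ _).trans ?_
  gcongr
  refine (norm_sum_le_of_le _ fun k _ => norm_log_branchRatio_iterate_le hz k).trans ?_
  exact sum_majorant_le m

lemma norm_logKoenigs_le {z : ℂ} (hz : ‖z‖ < 3 / 2) :
    ‖logKoenigs z‖ ≤ ‖Complex.log z‖ + 22 :=
  le_of_tendsto (tendsto_logApprox hz).norm (Eventually.of_forall (norm_logApprox_le hz))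

lemma differentiableAt_logKoenigs {z : ℂ} (hz : ‖z‖ < 3 / 2) (h : z ∈ Complex.slitPlane) :
    DifferentiableAt ℂ logKoenigs z := by
  have h1 := (Complex.differentiableOn_tsum_of_summable_norm summable_majorant
    differentiableOn_log_branchRatio_iterate Metric.isOpen_ball fun k w hw =>
      norm_log_branchRatio_iterate_le (mem_ball_zero_iff.1 hw) k).differentiableAt
        (Metric.isOpen_ball.mem_nhds (mem_ball_zero_iff.2 hz))
  exact (differentiableAt_id.clog h).add h1

lemma branchRatio_eq_ofReal {z : ℂ} (hz : z ∈ gasketInterval) :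
    ∃ r : ℝ, 0 < r ∧ branchRatio z = r := by
  obtain ⟨x, h0, h1, rfl⟩ := hz
  refine ⟨10 / (5 + Real.sqrt (25 - 16 * x)), by positivity, ?_⟩
  simp [branchRatio, discSqrt_ofReal h1]

lemma log_pow_mul_branchMinus_iterate {z : ℂ} (hz : z ∈ gasketInterval) (m : ℕ) :
    Complex.log (5 ^ m * branchMinus^[m] z) = logApprox m z := by
  induction m with
  | zero => simp [logApprox]
  | succ m ih =>
    have h : (5 : ℂ) ^ (m + 1) * branchMinus^[m + 1] z =
        5 ^ m * branchMinus^[m] z * branchRatio (branchMinus^[m] z) := by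
      rw [Function.iterate_succ_apply', pow_succ, mul_assoc, five_mul_branchMinus]; ring
    have hm := branchMinus_iterate_mem hz m
    obtain ⟨r, hr, hr'⟩ := branchRatio_eq_ofReal hm
    obtain ⟨x, h0, -, hx⟩ := hm
    have hne : (5 : ℂ) ^ m * branchMinus^[m] z ≠ 0 := by
      rw [hx]
      exact mul_ne_zero (pow_ne_zero _ (by norm_num)) (Complex.ofReal_ne_zero.2 h0.ne')
    have hl : logApprox (m + 1) z =
        logApprox m z + Complex.log (branchRatio (branchMinus^[m] z)) := by
      simp only [logApprox, Finset.sum_range_succ, add_assoc]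
    rw [hl, ← ih, h, hr', Complex.log_mul_ofReal _ hr _ hne, Complex.ofReal_log hr.le, add_comm]

lemma norm_branchPlus_lt {z : ℂ} (hz : z ∈ Metric.ball (5 / 8 : ℂ) (15 / 16)) :
    ‖branchPlus z‖ < 3 / 2 := by
  rw [mem_ball_iff_norm] at hz
  have h1 : ‖discSqrt z‖ ^ 2 ≤ 36 := by
    rw [← norm_pow, discSqrt_sq, show 25 - 16 * z = 15 - 16 * (z - 5 / 8) by ring]
    refine (norm_sub_le _ _).trans ?_
    rw [norm_mul, Complex.norm_ofNat, Complex.norm_ofNat]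
    linarith
  have h2 : ‖discSqrt z‖ ≤ 6 := by nlinarith [norm_nonneg (discSqrt z)]
  rw [branchPlus, norm_div, Complex.norm_ofNat]
  have h3 := norm_add_le 5 (discSqrt z)
  rw [Complex.norm_ofNat] at h3
  linarith

lemma branchPlus_mem_slitPlane (z : ℂ) : branchPlus z ∈ Complex.slitPlane := by
  have := discSqrt_re_nonneg z
  refine Or.inl ?_
  have h : branchPlus z = ((8⁻¹ : ℝ) : ℂ) * (5 + discSqrt z) := by
    unfold branchPlus; push_cast; ring
  rw [h, Complex.re_ofReal_mul]
  simp
  linarith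

lemma differentiableAt_branchPlus {z : ℂ} (hz : z ∈ Metric.ball (5 / 8 : ℂ) (15 / 16)) :
    DifferentiableAt ℂ branchPlus z := by
  rw [mem_ball_iff_norm] at hz
  have h : 0 < (25 - 16 * z).re := by
    have h1 := Complex.re_le_norm (z - 5 / 8)
    rw [show 25 - 16 * z = 15 - 16 * (z - 5 / 8) by ring, Complex.sub_re,
      show (16 : ℂ) = ((16 : ℝ) : ℂ) by simp, Complex.re_ofReal_mul]
    have : (15 : ℂ).re = 15 := by simp
    linarith
  have := differentiableAt_discSqrt h
  unfold branchPlus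
  fun_prop

lemma differentiableOn_logKoenigs_branchPlus :
    DifferentiableOn ℂ (fun z => logKoenigs (branchPlus z))
      (Metric.ball (5 / 8 : ℂ) (15 / 16)) := by
  intro z hz
  exact ((differentiableAt_logKoenigs (norm_branchPlus_lt hz)
    (branchPlus_mem_slitPlane z)).comp z (differentiableAt_branchPlus hz)).differentiableWithinAt

lemma exists_norm_log_le :
    ∃ B : ℝ, ∀ z ∈ Metric.closedBall (5 / 8 : ℂ) (9 / 10),
      (∀ m, ‖logApprox m (branchPlus z)‖ ≤ B) ∧ ‖logKoenigs (branchPlus z)‖ ≤ B := by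
  have hsub : Metric.closedBall (5 / 8 : ℂ) (9 / 10) ⊆ Metric.ball (5 / 8 : ℂ) (15 / 16) :=
    Metric.closedBall_subset_ball (by norm_num)
  have hc : ContinuousOn (fun z => Complex.log (branchPlus z))
      (Metric.closedBall (5 / 8 : ℂ) (9 / 10)) := fun z hz =>
    ((differentiableAt_branchPlus (hsub hz)).clog
      (branchPlus_mem_slitPlane z)).continuousAt.continuousWithinAt
  obtain ⟨C, hC⟩ := (isCompact_closedBall _ _).exists_bound_of_continuousOn hc
  refine ⟨C + 22, fun z hz => ⟨fun m => ?_, ?_⟩⟩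
  · exact (norm_logApprox_le (norm_branchPlus_lt (hsub hz)) m).trans
      (add_le_add_left (hC z hz) _)
  · exact (norm_logKoenigs_le (norm_branchPlus_lt (hsub hz))).trans
      (add_le_add_left (hC z hz) _)

lemma norm_exp_mul_le {s w : ℂ} {B : ℝ} (h : ‖w‖ ≤ B) :
    ‖Complex.exp (-s / 2 * w)‖ ≤ Real.exp (‖s‖ / 2 * B) := by
  refine (Complex.norm_exp_le_exp_norm _).trans (Real.exp_le_exp.2 ?_)
  rw [norm_mul, norm_div, norm_neg, Complex.norm_ofNat]
  gcongr

lemma norm_transfer_pow_sub_le {f : ℂ → ℂ} {M : ℝ}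
    (hf : DifferentiableOn ℂ f (Metric.ball (5 / 8 : ℂ) (15 / 16)))
    (hM : ∀ z ∈ Metric.closedBall (5 / 8 : ℂ) (9 / 10), ‖f z‖ ≤ M) (n : ℕ) {z w : ℂ}
    (hz : z ∈ gasketInterval) (hw : w ∈ gasketInterval) :
    ‖(transfer ^ n) f z - (transfer ^ n) f w‖ ≤ 576 * M * (1 / 4) ^ n := by
  set a : ℕ → ℂ := fun k => (k.factorial : ℂ)⁻¹ * iteratedDeriv k f (5 / 8) with ha
  have ha_le (k : ℕ) : ‖a k‖ ≤ M * (10 / 9) ^ k := by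
    have h := Complex.norm_iteratedDeriv_le_of_forall_mem_sphere_norm_le (c := 5 / 8)
      (R := 9 / 10) (C := M) (f := f) k (by norm_num)
      ((hf.mono (by
        rw [closure_ball _ (by norm_num)]
        exact Metric.closedBall_subset_ball (by norm_num))).diffContOnCl)
      (fun z hz => hM z (Metric.sphere_subset_closedBall hz))
    rw [ha, norm_mul, norm_inv, Complex.norm_natCast, inv_mul_le_iff₀ (by positivity)]
    refine h.trans (le_of_eq ?_)
    rw [show (10 / 9 : ℝ) = (9 / 10)⁻¹ by norm_num, inv_pow]
    ring
  have hsum : ∀ z ∈ gasketInterval, HasSum (fun k => (a k • centredPow k) z) (f z) := by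
    intro z hz
    have hz' : z ∈ Metric.ball (5 / 8 : ℂ) (15 / 16) := by
      rw [mem_ball_iff_norm]
      exact (norm_sub_le_of_mem hz).trans_lt (by norm_num)
    refine (Complex.hasSum_taylorSeries_on_ball hf hz').congr_fun fun k => ?_
    simp only [ha, centredPow, Pi.smul_apply, smul_eq_mul]
    ring
  have h1 := (hasSum_transfer_pow hsum n z hz).sub (hasSum_transfer_pow hsum n w hw)
  have h2 : HasSum (fun k : ℕ => 16 * M * (1 / 4) ^ n * (35 / 36 : ℝ) ^ k)
      (16 * M * (1 / 4) ^ n * (1 - 35 / 36)⁻¹) :=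
    (hasSum_geometric_of_lt_one (by norm_num) (by norm_num)).mul_left _
  have h3 := h1.norm_le_of_bounded h2 fun k => ?_
  · refine h3.trans (le_of_eq ?_)
    ring
  · simp only [map_smul, Pi.smul_apply, smul_eq_mul, ← mul_sub, norm_mul]
    refine (mul_le_mul (ha_le k) (norm_transfer_pow_centredPow_sub_le' n k hz hw)
      (norm_nonneg _) ((norm_nonneg _).trans (ha_le k))).trans (le_of_eq ?_)
    rw [show (35 / 36 : ℝ) = 10 / 9 * (7 / 8) by norm_num, mul_pow]
    ring

/-- The function `z ↦ Ψ(branchPlus z) ^ (-s / 2)`, for `Ψ` the Koenigs linearizer. -/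
noncomputable def plusPower (s z : ℂ) : ℂ := Complex.exp (-s / 2 * logKoenigs (branchPlus z))

/-- The approximations of `plusPower` that occur in the partial sums. -/
noncomputable def plusPowerApprox (m : ℕ) (s z : ℂ) : ℂ :=
  Complex.exp (-s / 2 * logApprox m (branchPlus z))

/-- The zeta function `ζ_{z,R}` of `gasketR`. -/
noncomputable def gasketZeta (z s : ℂ) : ℂ :=
  Complex.exp (-s / 2 * logKoenigs z) +
    ∑' j, ((5 : ℂ) ^ (-s / 2)) ^ (j + 1) * (transfer ^ j) (plusPower s) z

lemma gasketInterval_subset :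
    gasketInterval ⊆ Metric.closedBall (5 / 8 : ℂ) (9 / 10) := by
  intro z hz
  rw [mem_closedBall_iff_norm]
  exact (norm_sub_le_of_mem hz).trans (by norm_num)

lemma cpow_pow_mul_branchMinus_iterate {z : ℂ} (hz : z ∈ gasketInterval) (s : ℂ) (i m : ℕ) :
    (if branchMinus^[m] z = 0 then 0 else (5 ^ (m + i) * branchMinus^[m] z) ^ (-s / 2)) =
      ((5 : ℂ) ^ (-s / 2)) ^ i * Complex.exp (-s / 2 * logApprox m z) := by
  have hl := log_pow_mul_branchMinus_iterate hz m
  obtain ⟨x, h0, -, hx⟩ := branchMinus_iterate_mem hz m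
  have hne : branchMinus^[m] z ≠ 0 := by rw [hx]; exact Complex.ofReal_ne_zero.2 h0.ne'
  have h5 : (5 : ℂ) ^ m ≠ 0 := pow_ne_zero _ (by norm_num)
  have hr : (5 : ℂ) ^ (m + i) * branchMinus^[m] z =
      ((5 ^ i : ℝ) : ℂ) * (5 ^ m * branchMinus^[m] z) := by
    push_cast; ring
  have hne' : (5 : ℂ) ^ (m + i) * branchMinus^[m] z ≠ 0 :=
    mul_ne_zero (pow_ne_zero _ (by norm_num)) hne
  have hlog5 : Complex.log 5 = (Real.log 5 : ℝ) := by
    rw [Complex.ofReal_log (by norm_num)]; simp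
  rw [if_neg hne, Complex.cpow_def_of_ne_zero hne', hr,
    Complex.log_ofReal_mul (by positivity) (mul_ne_zero h5 hne), hl,
    Complex.cpow_def_of_ne_zero (by norm_num), ← Complex.exp_nat_mul, ← Complex.exp_add,
    Real.log_pow, hlog5]
  congr 1
  push_cast
  ring

lemma zetaPartial_eq_sum {z₀ : ℝ} (hz : (z₀ : ℂ) ∈ gasketInterval) (n : ℕ) (s : ℂ) :
    zetaPartial gasketR 5 z₀ n s = Complex.exp (-s / 2 * logApprox n z₀) +
      ∑ j ∈ Finset.range n, ((5 : ℂ) ^ (-s / 2)) ^ (j + 1) *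
        (transfer ^ j) (plusPowerApprox (n - 1 - j) s) z₀ := by
  rw [zetaPartial_eq_transfer_pow, transfer_pow_eq, LinearMap.add_apply, Pi.add_apply,
    pullMinus_pow_apply, LinearMap.sum_apply, Finset.sum_apply]
  congr 1
  · simpa using cpow_pow_mul_branchMinus_iterate hz s 0 n
  · refine Finset.sum_congr rfl fun j hj => ?_
    rw [Module.End.mul_apply]
    have h : ∀ z ∈ gasketInterval, (pullPlus * pullMinus ^ (n - 1 - j))
        (fun z => if z = 0 then 0 else (5 ^ n * z) ^ (-s / 2)) z =
        (((5 : ℂ) ^ (-s / 2)) ^ (j + 1) • plusPowerApprox (n - 1 - j) s) z := by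
      intro z hz
      have hn : n = (n - 1 - j) + (j + 1) := by
        have := Finset.mem_range.1 hj
        omega
      have h1 := cpow_pow_mul_branchMinus_iterate (branch_mem hz).2 s (j + 1) (n - 1 - j)
      rw [← hn] at h1
      rw [Module.End.mul_apply, Pi.smul_apply, smul_eq_mul, plusPowerApprox, ← h1]
      exact pullMinus_pow_apply _ _ _
    rw [transfer_pow_congr h j _ hz, map_smul, Pi.smul_apply, smul_eq_mul]

lemma norm_five_cpow (s : ℂ) : ‖(5 : ℂ) ^ s‖ = Real.exp (Real.log 5 * s.re) := by
  have h := Complex.norm_cpow_eq_rpow_re_of_pos (x := 5) (by norm_num) s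
  rw [Real.rpow_def_of_pos (by norm_num)] at h
  simpa using h

lemma log_five_pos : 0 < Real.log 5 := Real.log_pos (by norm_num)

lemma two_mul_norm_five_cpow_lt_one {s : ℂ} (hs : Real.log 4 / Real.log 5 < s.re) :
    2 * ‖(5 : ℂ) ^ (-s / 2)‖ < 1 := by
  rw [div_lt_iff₀ log_five_pos, show (4 : ℝ) = 2 ^ 2 by norm_num, Real.log_pow] at hs
  have h : Real.exp (Real.log 5 * (-s / 2).re) < Real.exp (-Real.log 2) := by
    refine Real.exp_lt_exp.2 ?_
    have : (-s / 2).re = -s.re / 2 := by simp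
    rw [this]
    push_cast at hs
    linarith
  rw [Real.exp_neg, Real.exp_log (by norm_num)] at h
  rw [norm_five_cpow]
  linarith

lemma norm_five_cpow_le_three {s : ℂ} (hs : -1 < s.re) : ‖(5 : ℂ) ^ (-s / 2)‖ ≤ 3 := by
  rw [norm_five_cpow, ← Real.le_log_iff_exp_le (by norm_num)]
  have h1 : (-s / 2).re = -s.re / 2 := by simp
  have h2 : Real.log 5 ≤ 2 * Real.log 3 := by
    have h := Real.log_le_log (x := 5) (y := 3 ^ 2) (by norm_num) (by norm_num)
    rwa [Real.log_pow] at h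
  have := log_five_pos
  rw [h1]
  nlinarith

lemma norm_zetaTerm_le {f : ℂ → ℂ} {M : ℝ} (hf : ∀ z ∈ gasketInterval, ‖f z‖ ≤ M) {z : ℂ}
    (hz : z ∈ gasketInterval) (y : ℂ) (j : ℕ) :
    ‖y ^ (j + 1) * (transfer ^ j) f z‖ ≤ ‖y‖ * M * (2 * ‖y‖) ^ j := by
  rw [norm_mul, norm_pow]
  refine (mul_le_mul_of_nonneg_left (norm_transfer_pow_le hf j z hz) (by positivity)).trans
    (le_of_eq ?_)
  rw [mul_pow, pow_succ]
  ring

lemma norm_plusPower_le {B : ℝ}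
    (hB : ∀ z ∈ Metric.closedBall (5 / 8 : ℂ) (9 / 10),
      (∀ m, ‖logApprox m (branchPlus z)‖ ≤ B) ∧ ‖logKoenigs (branchPlus z)‖ ≤ B)
    (s : ℂ) {z : ℂ} (hz : z ∈ Metric.closedBall (5 / 8 : ℂ) (9 / 10)) :
    ‖plusPower s z‖ ≤ Real.exp (‖s‖ / 2 * B) :=
  norm_exp_mul_le (hB z hz).2

lemma summable_zetaTerm {z s : ℂ} (hz : z ∈ gasketInterval)
    (hs : Real.log 4 / Real.log 5 < s.re) :
    Summable fun j => ((5 : ℂ) ^ (-s / 2)) ^ (j + 1) * (transfer ^ j) (plusPower s) z := by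
  obtain ⟨B, hB⟩ := exists_norm_log_le
  exact Summable.of_norm_bounded ((summable_geometric_of_lt_one (by positivity)
    (two_mul_norm_five_cpow_lt_one hs)).mul_left _) (norm_zetaTerm_le
      (fun w hw => norm_plusPower_le hB s (gasketInterval_subset hw)) hz _)

lemma tendsto_zetaPartial {z₀ : ℝ} (hz : (z₀ : ℂ) ∈ gasketInterval) {s : ℂ}
    (hs : Real.log 4 / Real.log 5 < s.re) :
    Tendsto (fun n => zetaPartial gasketR 5 z₀ n s) atTop (nhds (gasketZeta z₀ s)) := by
  obtain ⟨B, hB⟩ := exists_norm_log_le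
  have hexp {m : ℕ → ℕ} (hm : Tendsto m atTop atTop) {w : ℂ} (hw : ‖w‖ < 3 / 2) :
      Tendsto (fun n => Complex.exp (-s / 2 * logApprox (m n) w)) atTop
        (nhds (Complex.exp (-s / 2 * logKoenigs w))) :=
    (((tendsto_logApprox hw).comp hm).const_mul _).cexp
  simp only [zetaPartial_eq_sum hz]
  refine (hexp tendsto_id (norm_lt_of_mem hz)).add ?_
  set y := (5 : ℂ) ^ (-s / 2)
  have hsum (n : ℕ) : ∑ j ∈ Finset.range n,
      y ^ (j + 1) * (transfer ^ j) (plusPowerApprox (n - 1 - j) s) z₀ =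
      ∑' j, if j < n then
        y ^ (j + 1) * (transfer ^ j) (plusPowerApprox (n - 1 - j) s) z₀ else 0 := by
    rw [tsum_eq_sum (s := Finset.range n) fun j hj => if_neg (by simpa using hj)]
    exact Finset.sum_congr rfl fun j hj => (if_pos (Finset.mem_range.1 hj)).symm
  simp only [hsum]
  refine tendsto_tsum_of_dominated_convergence
    (bound := fun j => ‖y‖ * Real.exp (‖s‖ / 2 * B) * (2 * ‖y‖) ^ j)
    ((summable_geometric_of_lt_one (by positivity)
      (two_mul_norm_five_cpow_lt_one hs)).mul_left _) (fun j => ?_)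
    (Eventually.of_forall fun n j => ?_)
  · have h1 : Tendsto (fun n => y ^ (j + 1) *
        (transfer ^ j) (plusPowerApprox (n - 1 - j) s) z₀) atTop
        (nhds (y ^ (j + 1) * (transfer ^ j) (plusPower s) z₀)) := by
      refine (tendsto_transfer_pow (fun z hz => ?_) j _ hz).const_mul _
      refine hexp (m := fun n => n - 1 - j) ?_ (norm_lt_of_mem (branch_mem hz).2)
      simp only [Nat.sub_sub]
      exact tendsto_sub_atTop_nat _
    refine h1.congr' ?_
    filter_upwards [eventually_gt_atTop j] with n hn
    rw [if_pos hn]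
  · split_ifs
    · exact norm_zetaTerm_le (fun w hw => norm_exp_mul_le
        ((hB w (gasketInterval_subset hw)).1 _)) hz _ _
    · rw [norm_zero]
      positivity

lemma differentiable_five_cpow : Differentiable ℂ fun s : ℂ => (5 : ℂ) ^ (-s / 2) :=
  fun _ => DifferentiableAt.const_cpow (by fun_prop) (Or.inl (by norm_num))

lemma differentiable_plusPower (j : ℕ) (z : ℂ) :
    Differentiable ℂ fun s => (transfer ^ j) (plusPower s) z := by
  refine differentiable_transfer_pow (fun w => ?_) j z
  unfold plusPower
  fun_prop

lemma differentiableOn_tsum_five_cpow {g : ℕ → ℂ → ℂ} (hg : ∀ j, Differentiable ℂ (g j))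
    (hb : ∀ ρ : ℝ, ∃ C : ℝ, 0 ≤ C ∧ ∀ s : ℂ, ‖s‖ < ρ → ∀ j, ‖g j s‖ ≤ C * (1 / 4) ^ j) :
    DifferentiableOn ℂ (fun s => ∑' j, ((5 : ℂ) ^ (-s / 2)) ^ (j + 1) * g j s)
      {s | -1 < s.re} := by
  intro s₀ hs₀
  obtain ⟨C, hC0, hC⟩ := hb (‖s₀‖ + 1)
  have hU : IsOpen ({s : ℂ | -1 < s.re} ∩ Metric.ball 0 (‖s₀‖ + 1)) :=
    (isOpen_lt continuous_const Complex.continuous_re).inter Metric.isOpen_ball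
  refine ((Complex.differentiableOn_tsum_of_summable_norm
    (F := fun j s => ((5 : ℂ) ^ (-s / 2)) ^ (j + 1) * g j s)
    (u := fun j => 3 * C * (3 / 4 : ℝ) ^ j)
    ((summable_geometric_of_lt_one (by norm_num) (by norm_num)).mul_left _)
    (fun j => ((differentiable_five_cpow.pow _).mul (hg j)).differentiableOn) hU
    fun j s hs => ?_).differentiableAt
      (hU.mem_nhds ⟨hs₀, by simp⟩)).differentiableWithinAt
  have h1 : ‖(5 : ℂ) ^ (-s / 2)‖ ^ (j + 1) ≤ 3 ^ (j + 1) :=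
    pow_le_pow_left₀ (norm_nonneg _) (norm_five_cpow_le_three hs.1) _
  rw [norm_mul, norm_pow]
  refine (mul_le_mul h1 (hC s (mem_ball_zero_iff.1 hs.2) j) (norm_nonneg _)
    (by positivity)).trans (le_of_eq ?_)
  rw [show (3 / 4 : ℝ) = 3 * (1 / 4) by norm_num, mul_pow, pow_succ]
  ring

lemma exists_norm_transfer_plusPower_sub_le (ρ : ℝ) :
    ∃ C : ℝ, 0 ≤ C ∧ ∀ s : ℂ, ‖s‖ < ρ → ∀ j, ∀ z ∈ gasketInterval, ∀ w ∈ gasketInterval,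
      ‖(transfer ^ j) (plusPower s) z - (transfer ^ j) (plusPower s) w‖ ≤ C * (1 / 4) ^ j := by
  obtain ⟨B, hB⟩ := exists_norm_log_le
  have hB0 : 0 ≤ B := (norm_nonneg _).trans
    (hB (5 / 8) (Metric.mem_closedBall_self (by norm_num))).2
  refine ⟨576 * Real.exp (ρ / 2 * B), by positivity, fun s hs j z hz w hw => ?_⟩
  refine norm_transfer_pow_sub_le ?_ (fun z hz => ?_) j hz hw
  · exact (differentiableOn_logKoenigs_branchPlus.const_mul _).cexp
  · exact (norm_plusPower_le hB s hz).trans (Real.exp_le_exp.2 (by gcongr))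

/-- The analytic continuation of `gasketZeta z - gasketZeta w`. -/
noncomputable def zetaDiff (z w s : ℂ) : ℂ :=
  Complex.exp (-s / 2 * logKoenigs z) - Complex.exp (-s / 2 * logKoenigs w) +
    ∑' j, ((5 : ℂ) ^ (-s / 2)) ^ (j + 1) *
      ((transfer ^ j) (plusPower s) z - (transfer ^ j) (plusPower s) w)

/-- The analytic continuation of `(5 ^ (s / 2) - 2) * gasketZeta z s`. -/
noncomputable def zetaRegular (z s : ℂ) : ℂ :=
  ((5 : ℂ) ^ (s / 2) - 2) * Complex.exp (-s / 2 * logKoenigs z) + plusPower s z +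
    ∑' j, ((5 : ℂ) ^ (-s / 2)) ^ (j + 1) *
      ((transfer ^ (j + 1)) (plusPower s) z - 2 * (transfer ^ j) (plusPower s) z)

lemma isOpen_halfPlane : IsOpen {s : ℂ | -1 < s.re} :=
  isOpen_lt continuous_const Complex.continuous_re

lemma analyticAt_five_cpow (s : ℂ) : AnalyticAt ℂ (fun s : ℂ => (5 : ℂ) ^ (s / 2)) s := by
  refine Differentiable.analyticAt (fun _ => ?_) s
  exact DifferentiableAt.const_cpow (by fun_prop) (Or.inl (by norm_num))

lemma analyticAt_zetaDiff {z w : ℂ} (hz : z ∈ gasketInterval) (hw : w ∈ gasketInterval)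
    {s : ℂ} (hs : -1 < s.re) : AnalyticAt ℂ (zetaDiff z w) s := by
  refine DifferentiableOn.analyticAt (s := {s | -1 < s.re}) ?_ (isOpen_halfPlane.mem_nhds hs)
  refine DifferentiableOn.add (Differentiable.differentiableOn (by fun_prop)) ?_
  refine differentiableOn_tsum_five_cpow
    (fun j => (differentiable_plusPower j z).sub (differentiable_plusPower j w)) fun ρ => ?_
  obtain ⟨C, hC0, hC⟩ := exists_norm_transfer_plusPower_sub_le ρ
  exact ⟨C, hC0, fun s hs j => hC s hs j z hz w hw⟩

lemma analyticAt_zetaRegular {z : ℂ} (hz : z ∈ gasketInterval) {s : ℂ} (hs : -1 < s.re) :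
    AnalyticAt ℂ (zetaRegular z) s := by
  refine DifferentiableOn.analyticAt (s := {s | -1 < s.re}) ?_ (isOpen_halfPlane.mem_nhds hs)
  have hx : Differentiable ℂ fun s : ℂ => (5 : ℂ) ^ (s / 2) :=
    fun s => (analyticAt_five_cpow s).differentiableAt
  have h0 : Differentiable ℂ fun s => plusPower s z := differentiable_plusPower 0 z
  refine DifferentiableOn.add (Differentiable.differentiableOn (by fun_prop)) ?_
  refine differentiableOn_tsum_five_cpow (fun j =>
    (differentiable_plusPower (j + 1) z).sub ((differentiable_plusPower j z).const_mul 2))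
    fun ρ => ?_
  obtain ⟨C, hC0, hC⟩ := exists_norm_transfer_plusPower_sub_le ρ
  refine ⟨2 * C, by positivity, fun s hs j => ?_⟩
  have h1 := hC s hs j _ (branch_mem hz).1 z hz
  have h2 := hC s hs j _ (branch_mem hz).2 z hz
  rw [transfer_pow_succ_apply, two_mul, add_sub_add_comm]
  refine (norm_add_le _ _).trans ?_
  linarith

lemma zetaDiff_eq {z w s : ℂ} (hz : z ∈ gasketInterval) (hw : w ∈ gasketInterval)
    (hs : Real.log 4 / Real.log 5 < s.re) :
    zetaDiff z w s = gasketZeta z s - gasketZeta w s := by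
  simp only [zetaDiff, gasketZeta, mul_sub]
  rw [(summable_zetaTerm hz hs).tsum_sub (summable_zetaTerm hw hs)]
  ring

lemma zetaRegular_eq {z s : ℂ} (hz : z ∈ gasketInterval)
    (hs : Real.log 4 / Real.log 5 < s.re) :
    zetaRegular z s = ((5 : ℂ) ^ (s / 2) - 2) * gasketZeta z s := by
  have hxy : (5 : ℂ) ^ (s / 2) * (5 : ℂ) ^ (-s / 2) = 1 := by
    rw [← Complex.cpow_add _ _ (by norm_num)]
    ring_nf
    simp
  have hsum := summable_zetaTerm hz hs
  rw [zetaRegular, gasketZeta]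
  set x := (5 : ℂ) ^ (s / 2)
  set y := (5 : ℂ) ^ (-s / 2)
  have h1 (j : ℕ) : x * (y ^ (j + 1) * (transfer ^ j) (plusPower s) z) =
      y ^ j * (transfer ^ j) (plusPower s) z := by
    rw [pow_succ]
    linear_combination (y ^ j * (transfer ^ j) (plusPower s) z) * hxy
  have hsum' : Summable fun j => y ^ j * (transfer ^ j) (plusPower s) z := by
    simpa only [h1] using hsum.mul_left x
  have h2 : x * ∑' j, y ^ (j + 1) * (transfer ^ j) (plusPower s) z =
      plusPower s z + ∑' j, y ^ (j + 1) * (transfer ^ (j + 1)) (plusPower s) z := by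
    rw [← tsum_mul_left]
    simp only [h1]
    rw [hsum'.tsum_eq_zero_add]
    simp
  have h3 : ∑' j, y ^ (j + 1) *
      ((transfer ^ (j + 1)) (plusPower s) z - 2 * (transfer ^ j) (plusPower s) z) =
      ∑' j, y ^ (j + 1) * (transfer ^ (j + 1)) (plusPower s) z -
        2 * ∑' j, y ^ (j + 1) * (transfer ^ j) (plusPower s) z := by
    rw [← tsum_mul_left, ← Summable.tsum_sub ((summable_nat_add_iff 1).2 hsum')
      (hsum.mul_left 2)]
    refine tsum_congr fun j => ?_
    ring
  rw [h3]
  linear_combination -h2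

lemma exists_eq_of_five_cpow_eq {s : ℂ} {r : ℝ} (hr : 0 < r)
    (h : (5 : ℂ) ^ (s / 2) = r) :
    ∃ k : ℤ, s = ((Real.log (r ^ 2) : ℂ) + 2 * Real.pi * Complex.I * (k : ℂ)) /
      (Real.log 5 : ℂ) := by
  have hlog5 : Complex.log 5 = (Real.log 5 : ℝ) := by
    rw [Complex.ofReal_log (by norm_num)]; simp
  have h5 : (Real.log 5 : ℂ) ≠ 0 := Complex.ofReal_ne_zero.2 log_five_pos.ne'
  rw [Complex.cpow_def_of_ne_zero (by norm_num), hlog5, ← Real.exp_log hr, Complex.ofReal_exp,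
    Complex.exp_eq_exp_iff_exists_int] at h
  obtain ⟨n, hn⟩ := h
  refine ⟨2 * n, ?_⟩
  rw [eq_div_iff h5, Real.log_pow]
  push_cast
  linear_combination 2 * hn

theorem sierpinski_gasket_spectral_zeta :
    ∃ ζ₁ ζ₂ : ℂ → ℂ,
      (∀ s : ℂ, Real.log 4 / Real.log 5 < s.re →
        Filter.Tendsto (fun n => zetaPartial gasketR 5 (3 / 4) n s) Filter.atTop (nhds (ζ₁ s)) ∧
        Filter.Tendsto (fun n => zetaPartial gasketR 5 (5 / 4) n s) Filter.atTop (nhds (ζ₂ s))) ∧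
      ∃ F : ℂ → ℂ,
        MeromorphicOn F {s : ℂ | -1 < s.re} ∧
        (∀ s : ℂ, -1 < s.re →
          (¬ ∃ k : ℤ, s = 2 * Real.pi * Complex.I * (k : ℂ) / (Real.log 5 : ℂ) ∨
            s = ((Real.log 9 : ℂ) + 2 * Real.pi * Complex.I * (k : ℂ)) / (Real.log 5 : ℂ)) →
          AnalyticAt ℂ F s) ∧
        (∀ s : ℂ, Real.log 9 / Real.log 5 < s.re →
          F s = (1 / 2) * ζ₁ s *
              (1 / ((5 : ℂ) ^ (s / 2) - 3) + 3 / ((5 : ℂ) ^ (s / 2) - 1)) +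
            (1 / 2) * ζ₂ s *
              (3 * (5 : ℂ) ^ (-s / 2) / ((5 : ℂ) ^ (s / 2) - 3) -
                (5 : ℂ) ^ (-s / 2) / ((5 : ℂ) ^ (s / 2) - 1))) := by

  have hmem₁ : ((3 / 4 : ℝ) : ℂ) ∈ gasketInterval := ⟨3 / 4, by norm_num, by norm_num, rfl⟩
  have hmem₂ : ((5 / 4 : ℝ) : ℂ) ∈ gasketInterval := ⟨5 / 4, by norm_num, by norm_num, rfl⟩
  refine ⟨gasketZeta (3 / 4 : ℝ), gasketZeta (5 / 4 : ℝ),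
    fun s hs => ⟨tendsto_zetaPartial hmem₁ hs, tendsto_zetaPartial hmem₂ hs⟩,
    fun s => 1 / 2 * zetaDiff (3 / 4 : ℝ) (5 / 4 : ℝ) s *
        (1 / ((5 : ℂ) ^ (s / 2) - 3) + 3 / ((5 : ℂ) ^ (s / 2) - 1)) +
      2 * zetaRegular (5 / 4 : ℝ) s / (((5 : ℂ) ^ (s / 2) - 1) * ((5 : ℂ) ^ (s / 2) - 3)),
    fun s hs => ?_, fun s hs hk => ?_, fun s hs => ?_⟩
  · have h1 := (analyticAt_zetaDiff hmem₁ hmem₂ hs).meromorphicAt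
    have h2 := (analyticAt_zetaRegular hmem₂ hs).meromorphicAt
    have h3 := (analyticAt_five_cpow s).meromorphicAt
    fun_prop
  · have h1 := analyticAt_zetaDiff hmem₁ hmem₂ hs
    have h2 := analyticAt_zetaRegular hmem₂ hs
    have h3 := analyticAt_five_cpow s
    have hx1 : (5 : ℂ) ^ (s / 2) - 1 ≠ 0 := by
      intro h
      obtain ⟨k, hs⟩ := exists_eq_of_five_cpow_eq one_pos (by simpa using sub_eq_zero.1 h)
      exact hk ⟨k, Or.inl (by simpa using hs)⟩
    have hx3 : (5 : ℂ) ^ (s / 2) - 3 ≠ 0 := by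
      intro h
      obtain ⟨k, hs⟩ := exists_eq_of_five_cpow_eq (r := 3) (by norm_num)
        (by simpa using sub_eq_zero.1 h)
      exact hk ⟨k, Or.inr (by rw [hs]; norm_num)⟩
    have hx := mul_ne_zero hx1 hx3
    fun_prop (disch := assumption)
  · have hs' : Real.log 4 / Real.log 5 < s.re := by
      refine lt_of_le_of_lt ?_ hs
      have := log_five_pos
      gcongr
      norm_num
    have hnorm : 3 < ‖(5 : ℂ) ^ (s / 2)‖ := by
      rw [div_lt_iff₀ log_five_pos, show (9 : ℝ) = 3 ^ 2 by norm_num, Real.log_pow] at hs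
      rw [norm_five_cpow, ← Real.log_lt_iff_lt_exp (by norm_num)]
      have : (s / 2).re = s.re / 2 := by simp
      rw [this]
      push_cast at hs
      linarith
    have hx0 : (5 : ℂ) ^ (s / 2) ≠ 0 := norm_pos_iff.1 (by linarith)
    have hx1 : (5 : ℂ) ^ (s / 2) - 1 ≠ 0 := by
      intro h
      rw [sub_eq_zero.1 h, norm_one] at hnorm
      linarith
    have hx3 : (5 : ℂ) ^ (s / 2) - 3 ≠ 0 := by
      intro h
      rw [sub_eq_zero.1 h, Complex.norm_ofNat] at hnorm
      linarith
    have hy : (5 : ℂ) ^ (-s / 2) = ((5 : ℂ) ^ (s / 2))⁻¹ := by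
      rw [neg_div, Complex.cpow_neg]
    simp only [zetaDiff_eq hmem₁ hmem₂ hs', zetaRegular_eq hmem₂ hs', hy]
    field_simp
    ring
end

section
/- For n ∈ ℕ let Δ_n be the (2ⁿ+1)×(2ⁿ+1) real matrix of the Neumann probabilistic Laplacian on the path {0,…,2ⁿ}, and let R(z) = 2z(2 − z). Then: (i) for every real z ≠ 1 and every n, the dimension of ker(Δ_n − R(z)·I) equals the dimension of ker(Δ_{n+1} − z·I) (i.e., R(z) is an eigenvalue of Δ_n if and only if z is an eigenvalue of Δ_{n+1}, with the same multiplicity); (ii) each Δ_n has simple spectrum, i.e., it has 2ⁿ+1 distinct real eigenvalues; (iii) the set of eigenvalues of Δ_0 is {0, 2}; and (iv) 1 is an eigenvalue of Δ_n for every n ≥ 1. -/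
open Matrix

/-- The Neumann probabilistic Laplacian on the path `{0, …, 2ⁿ}`:
`(Δ_n f)(k) = f(k) − ½f(k−1) − ½f(k+1)` for `0 < k < 2ⁿ`, with Neumann boundary rows
`(Δ_n f)(0) = f(0) − f(1)` and `(Δ_n f)(2ⁿ) = f(2ⁿ) − f(2ⁿ−1)`. -/
noncomputable def pathLap (n : ℕ) : Matrix (Fin (2 ^ n + 1)) (Fin (2 ^ n + 1)) ℝ :=
  Matrix.of fun i j =>
    if i = j then 1
    else if i.val = 0 ∧ j.val = 1 then -1
    else if i.val = 2 ^ n ∧ j.val = 2 ^ n - 1 then -1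
    else if 0 < i.val ∧ i.val < 2 ^ n ∧ (j.val + 1 = i.val ∨ j.val = i.val + 1) then -(1 / 2)
    else 0

/-- The multiplicity of `z` as an eigenvalue of `Δ_n`, i.e. `dim ker (Δ_n − z·I)`. -/
noncomputable def pathMult (n : ℕ) (z : ℝ) : ℕ :=
  Module.finrank ℝ (LinearMap.ker ((pathLap n - z • (1 : Matrix _ _ ℝ)).mulVecLin))

/-- `z` is an eigenvalue of `Δ_n`. -/
def pathEig (n : ℕ) (z : ℝ) : Prop :=
  LinearMap.ker ((pathLap n - z • (1 : Matrix _ _ ℝ)).mulVecLin) ≠ ⊥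

open Polynomial in
theorem chebyshevT_sq_add_sq (x : ℝ) (m : ℕ) :
    ((Chebyshev.T ℝ (m + 1 : ℤ)).eval x - x * (Chebyshev.T ℝ m).eval x) ^ 2 =
      (1 - x ^ 2) * (1 - (Chebyshev.T ℝ m).eval x ^ 2) := by
  induction m with
  | zero => simp
  | succ m ih =>
    have h : (Chebyshev.T ℝ (m + 2 : ℤ)).eval x =
        2 * x * (Chebyshev.T ℝ (m + 1 : ℤ)).eval x - (Chebyshev.T ℝ m).eval x := by
      simp [Chebyshev.T_add_two]
    push_cast
    rw [add_assoc, one_add_one_eq_two, h]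
    linear_combination ih

open Polynomial in
/-- The Neumann condition at the right endpoint `m + 1`. -/
theorem chebyshevT_eq_mul_iff (x : ℝ) (m : ℕ) :
    (Chebyshev.T ℝ m).eval x = x * (Chebyshev.T ℝ (m + 1 : ℤ)).eval x ↔
      |(Chebyshev.T ℝ (m + 1 : ℤ)).eval x| = 1 := by
  have h := chebyshevT_sq_add_sq x (m + 1)
  have hrec : (Chebyshev.T ℝ (m + 2 : ℤ)).eval x =
      2 * x * (Chebyshev.T ℝ (m + 1 : ℤ)).eval x - (Chebyshev.T ℝ m).eval x := by
    simp [Chebyshev.T_add_two]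
  push_cast at h
  rw [add_assoc, one_add_one_eq_two, hrec] at h
  constructor
  · intro he
    have h0 : (1 - x ^ 2) * (1 - (Chebyshev.T ℝ (m + 1 : ℤ)).eval x ^ 2) = 0 := by
      rw [← h, he]; ring
    rcases mul_eq_zero.mp h0 with hx | hT
    · rcases sq_eq_one_iff.1 (sub_eq_zero.1 hx).symm with rfl | rfl <;> simp
    · exact (sq_eq_sq₀ (abs_nonneg _) zero_le_one).1 (by rw [sq_abs]; linarith)
  · intro ha
    have hsq : (Chebyshev.T ℝ (m + 1 : ℤ)).eval x ^ 2 = 1 := by rw [← sq_abs, ha, one_pow]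
    rw [hsq, sub_self, mul_zero] at h
    linarith [pow_eq_zero_iff (two_ne_zero) |>.1 h]

theorem pathLap_mulVec_zero (n : ℕ) (g : ℕ → ℝ) :
    (pathLap n *ᵥ fun i => g i) 0 = g 0 - g 1 := by
  have h1 : 1 < 2 ^ n + 1 := by have := Nat.one_le_two_pow (n := n); omega
  have key : ∀ j : Fin (2 ^ n + 1), pathLap n 0 j * g j =
      (if j = 0 then g j else 0) - (if j = ⟨1, h1⟩ then g j else 0) := by
    intro j
    simp only [pathLap, Matrix.of_apply, Fin.ext_iff, Fin.val_zero]
    grind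
  simp [Matrix.mulVec, dotProduct, key, Finset.sum_sub_distrib]

theorem pathLap_mulVec_last (n : ℕ) (g : ℕ → ℝ) :
    (pathLap n *ᵥ fun i => g i) (Fin.last _) = g (2 ^ n) - g (2 ^ n - 1) := by
  have h2 : 1 ≤ 2 ^ n := Nat.one_le_two_pow
  have h1 : 2 ^ n - 1 < 2 ^ n + 1 := by omega
  have key : ∀ j : Fin (2 ^ n + 1), pathLap n (Fin.last _) j * g j =
      (if j = Fin.last _ then g j else 0) - (if j = ⟨2 ^ n - 1, h1⟩ then g j else 0) := by
    intro j
    simp only [pathLap, Matrix.of_apply, Fin.ext_iff, Fin.val_last]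
    grind
  simp [Matrix.mulVec, dotProduct, key, Finset.sum_sub_distrib]

theorem pathLap_mulVec_interior (n : ℕ) (g : ℕ → ℝ) (k : ℕ) (hk : k + 1 < 2 ^ n) :
    (pathLap n *ᵥ fun i => g i) ⟨k + 1, by omega⟩ =
      g (k + 1) - 1 / 2 * g k - 1 / 2 * g (k + 2) := by
  have key : ∀ j : Fin (2 ^ n + 1), pathLap n ⟨k + 1, by omega⟩ j * g j =
      (if j = ⟨k + 1, by omega⟩ then g j else 0) - (if j = ⟨k, by omega⟩ then 1 / 2 * g j else 0)
        - (if j = ⟨k + 2, by omega⟩ then 1 / 2 * g j else 0) := by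
    intro j
    simp only [pathLap, Matrix.of_apply, Fin.ext_iff]
    grind
  simp [Matrix.mulVec, dotProduct, key, Finset.sum_sub_distrib]

theorem mem_ker_pathLap_iff (n : ℕ) (z : ℝ) (g : ℕ → ℝ) :
    (fun i : Fin (2 ^ n + 1) => g i) ∈
        LinearMap.ker ((pathLap n - z • (1 : Matrix _ _ ℝ)).mulVecLin) ↔
      g 1 = (1 - z) * g 0 ∧
      (∀ k, k + 1 < 2 ^ n → g (k + 2) = 2 * (1 - z) * g (k + 1) - g k) ∧
      g (2 ^ n - 1) = (1 - z) * g (2 ^ n) := by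
  have hmem : (fun i : Fin (2 ^ n + 1) => g i) ∈
        LinearMap.ker ((pathLap n - z • (1 : Matrix _ _ ℝ)).mulVecLin) ↔
      ∀ i : Fin (2 ^ n + 1), (pathLap n *ᵥ fun i => g i) i = z * g i := by
    simp [LinearMap.mem_ker, funext_iff, sub_eq_zero]
  rw [hmem]
  constructor
  · intro h
    refine ⟨?_, fun k hk => ?_, ?_⟩
    · have := h 0
      rw [pathLap_mulVec_zero, Fin.val_zero] at this
      linarith
    · have := h ⟨k + 1, by omega⟩
      rw [pathLap_mulVec_interior n g k hk] at this
      linarith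
    · have := h (Fin.last _)
      rw [pathLap_mulVec_last, Fin.val_last] at this
      linarith
  · rintro ⟨h0, hi, hl⟩ ⟨_ | k, hk⟩
    · rw [Fin.mk_zero', pathLap_mulVec_zero, Fin.val_zero]
      linarith
    · rcases Nat.lt_or_ge (k + 1) (2 ^ n) with h | h
      · rw [pathLap_mulVec_interior n g k h]
        linarith [hi k h]
      · have he : (⟨k + 1, hk⟩ : Fin (2 ^ n + 1)) = Fin.last _ := Fin.ext (by simp; omega)
        rw [he, pathLap_mulVec_last, Fin.val_last]
        linarith

open Polynomial in
theorem eq_chebyshevT_of_mem_ker {n : ℕ} {z : ℝ} {g : ℕ → ℝ}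
    (h : (fun i : Fin (2 ^ n + 1) => g i) ∈
        LinearMap.ker ((pathLap n - z • (1 : Matrix _ _ ℝ)).mulVecLin)) (k : ℕ) (hk : k ≤ 2 ^ n) :
    g k = g 0 * (Chebyshev.T ℝ k).eval (1 - z) := by
  obtain ⟨h0, hi, -⟩ := (mem_ker_pathLap_iff n z g).1 h
  induction k using Nat.twoStepInduction with
  | zero => simp
  | one => simp [h0, mul_comm]
  | more k ih1 ih2 =>
    rw [hi k (by omega), ih1 (by omega), ih2 (by omega)]
    push_cast
    simp only [Chebyshev.T_add_two, eval_sub, eval_mul, eval_ofNat, eval_X]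
    ring

open Polynomial in
theorem chebyshevT_mem_ker_iff (n : ℕ) (z : ℝ) :
    (fun i : Fin (2 ^ n + 1) => (Chebyshev.T ℝ (i : ℕ)).eval (1 - z)) ∈
        LinearMap.ker ((pathLap n - z • (1 : Matrix _ _ ℝ)).mulVecLin) ↔
      |(Chebyshev.T ℝ (2 ^ n : ℕ)).eval (1 - z)| = 1 := by
  rw [mem_ker_pathLap_iff n z fun i => (Chebyshev.T ℝ (i : ℕ)).eval (1 - z)]
  obtain ⟨m, hm⟩ := Nat.exists_eq_succ_of_ne_zero (Nat.two_pow_pos n).ne'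
  have := chebyshevT_eq_mul_iff (1 - z) m
  simp only [hm, Nat.succ_eq_add_one, Nat.add_sub_cancel]
  push_cast
  simp [← this, Chebyshev.T_add_two]

open Polynomial in
theorem pathEig_iff (n : ℕ) (z : ℝ) :
    pathEig n z ↔ |(Chebyshev.T ℝ (2 ^ n : ℕ)).eval (1 - z)| = 1 := by
  rw [← chebyshevT_mem_ker_iff, pathEig, Submodule.ne_bot_iff]
  constructor
  · rintro ⟨f, hf, hne⟩
    obtain ⟨g, rfl⟩ : ∃ g : ℕ → ℝ, f = fun i : Fin (2 ^ n + 1) => g i :=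
      ⟨fun k => if hk : k < 2 ^ n + 1 then f ⟨k, hk⟩ else 0, by ext i; simp [i.is_le]⟩
    have hg : (fun i : Fin (2 ^ n + 1) => g i) =
        g 0 • fun i : Fin (2 ^ n + 1) => (Chebyshev.T ℝ (i : ℕ)).eval (1 - z) := by
      ext i
      exact eq_chebyshevT_of_mem_ker hf i (by omega)
    have h0 : g 0 ≠ 0 := by
      rintro h0
      exact hne (by rw [hg, h0, zero_smul])
    rw [hg] at hf
    exact (Submodule.smul_mem_iff _ h0).1 hf
  · intro h
    exact ⟨_, h, fun h0 => by simpa using congrFun h0 0⟩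

open Polynomial in
theorem pathMult_eq_one {n : ℕ} {z : ℝ} (h : pathEig n z) : pathMult n z = 1 := by
  have hT := (chebyshevT_mem_ker_iff n z).2 ((pathEig_iff n z).1 h)
  rw [pathMult, finrank_eq_one_iff_of_nonzero' ⟨_, hT⟩
    fun h0 => by simpa using congrFun (congrArg Subtype.val h0) 0]
  rintro ⟨f, hf⟩
  obtain ⟨g, rfl⟩ : ∃ g : ℕ → ℝ, f = fun i : Fin (2 ^ n + 1) => g i :=
    ⟨fun k => if hk : k < 2 ^ n + 1 then f ⟨k, hk⟩ else 0, by ext i; simp [i.is_le]⟩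
  refine ⟨g 0, Subtype.ext (funext fun i => ?_)⟩
  exact (eq_chebyshevT_of_mem_ker hf i (by omega)).symm

theorem pathMult_eq_zero {n : ℕ} {z : ℝ} (h : ¬ pathEig n z) : pathMult n z = 0 :=
  Submodule.finrank_eq_zero.2 (not_not.1 h)

open Polynomial in
theorem pathEig_decimation (n : ℕ) (z : ℝ) :
    pathEig n (2 * z * (2 - z)) ↔ pathEig (n + 1) z := by
  have h2 : 1 - 2 * z * (2 - z) = (Chebyshev.T ℝ 2).eval (1 - z) := by
    simp [Chebyshev.T_two]
    ring
  rw [pathEig_iff, pathEig_iff, h2, ← eval_comp, ← Chebyshev.T_mul, pow_succ]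
  push_cast
  rfl

theorem pathEig_iff_exists_cos (n : ℕ) (z : ℝ) :
    pathEig n z ↔ ∃ k : ℕ, k ≤ 2 ^ n ∧ z = 1 - Real.cos (k * Real.pi / (2 ^ n : ℕ)) := by
  rw [pathEig_iff, Polynomial.Chebyshev.abs_eval_T_real_eq_one_iff (Nat.two_pow_pos n).ne']
  exact exists_congr fun k => and_congr_right fun _ => by
    constructor <;> intro h <;> linarith

theorem injOn_cos_mul_pi_div {N : ℕ} (hN : N ≠ 0) :
    Set.InjOn (fun k : ℕ => 1 - Real.cos (k * Real.pi / N)) (Finset.range (N + 1)) := by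
  have hN' : (0 : ℝ) < N := by positivity
  have hmem : ∀ k ∈ Finset.range (N + 1), (k * Real.pi / N : ℝ) ∈ Set.Icc 0 Real.pi := by
    intro k hk
    have hk' : (k : ℝ) ≤ N := by exact_mod_cast Finset.mem_range_succ_iff.1 hk
    refine ⟨by positivity, ?_⟩
    rw [div_le_iff₀ hN', mul_comm]
    gcongr
  intro a ha b hb hab
  have := Real.injOn_cos (hmem a ha) (hmem b hb) (by simpa using hab)
  have hpi := Real.pi_ne_zero
  field_simp at this
  exact_mod_cast this

theorem path_laplacian_spectral_decimation :
    (∀ z : ℝ, z ≠ 1 → ∀ n : ℕ, pathMult n (2 * z * (2 - z)) = pathMult (n + 1) z) ∧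
    (∀ n : ℕ, ∃ S : Finset ℝ, S.card = 2 ^ n + 1 ∧
      (∀ z : ℝ, z ∈ S ↔ pathEig n z) ∧ ∀ z ∈ S, pathMult n z = 1) ∧
    ({z : ℝ | pathEig 0 z} = {0, 2}) ∧
    (∀ n : ℕ, 1 ≤ n → pathEig n 1) := by
  refine ⟨fun z _ n => ?_, fun n => ?_, ?_, fun n hn => ?_⟩
  · by_cases h : pathEig (n + 1) z
    · rw [pathMult_eq_one h, pathMult_eq_one ((pathEig_decimation n z).2 h)]
    · rw [pathMult_eq_zero h, pathMult_eq_zero (mt (pathEig_decimation n z).1 h)]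
  · have hmem : ∀ z : ℝ, z ∈ (Finset.range (2 ^ n + 1)).image
        (fun k : ℕ => 1 - Real.cos (k * Real.pi / (2 ^ n : ℕ))) ↔ pathEig n z := by
      intro z
      simp only [pathEig_iff_exists_cos, Finset.mem_image, Finset.mem_range_succ_iff,
        eq_comm (b := z)]
    refine ⟨_, ?_, hmem, fun z hz => pathMult_eq_one ((hmem z).1 hz)⟩
    rw [Finset.card_image_of_injOn (injOn_cos_mul_pi_div (Nat.two_pow_pos n).ne'),
      Finset.card_range]
  · ext z
    have : pathEig 0 z ↔ |1 - z| = 1 := by simp [pathEig_iff]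
    simp only [Set.mem_ofPred_eq, this, Set.mem_insert_iff, Set.mem_singleton_iff]
    grind
  · obtain ⟨m, rfl⟩ := Nat.exists_eq_add_of_le' hn
    rw [← pathEig_decimation, pathEig_iff_exists_cos]
    refine ⟨2 ^ m, le_rfl, ?_⟩
    rw [mul_div_cancel_left₀ _ (Nat.cast_ne_zero.2 (Nat.two_pow_pos m).ne'), Real.cos_pi]
    norm_num
end

section
/- Fix 0 < p < 1 and set q = 1 − p, and let Δ_{p,n} be the (3ⁿ+1)×(3ⁿ+1) Neumann random-walk Laplacian matrices defined via the substitution sequences S_n, and R_p(z) = z(z² + 3z + 2 + pq)/(pq). Then for every real z ∉ {−1+p, −1−p} and every n, the dimension of ker(Δ_{p,n} − R_p(z)·I) equals the dimension of ker(Δ_{p,n+1} − z·I) (i.e., R_p(z) is an eigenvalue of Δ_{p,n} if and only if z is an eigenvalue of Δ_{p,n+1}, with the same multiplicity). Moreover each Δ_{p,n} has simple spectrum (3ⁿ+1 distinct real eigenvalues), and the set of eigenvalues of Δ_{p,0} is {0, −2}. -/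
open Matrix

/-- The substitution sequences `S_n` over `{p, q}`: `S_0 = ()` and
`S_{n+1} = S_n ⌢ (p) ⌢ S_n ⌢ (q) ⌢ S_n`. -/
def subSeq (p q : ℝ) : ℕ → List ℝ
  | 0 => []
  | n + 1 => subSeq p q n ++ [p] ++ subSeq p q n ++ [q] ++ subSeq p q n

/-- The Neumann random-walk Laplacian on `{0, …, 3ⁿ}`:
`(Δ_{p,n} f)(k) = (1 − s_k)f(k−1) + s_k f(k+1) − f(k)` for `0 < k < 3ⁿ`, where `s_k` is the
`k`-th entry of `S_n`, with Neumann boundary rows `(Δ_{p,n} f)(0) = f(1) − f(0)` and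
`(Δ_{p,n} f)(3ⁿ) = f(3ⁿ−1) − f(3ⁿ)`. -/
noncomputable def fracLap (p : ℝ) (n : ℕ) : Matrix (Fin (3 ^ n + 1)) (Fin (3 ^ n + 1)) ℝ :=
  Matrix.of fun i j =>
    if i = j then -1
    else if i.val = 0 ∧ j.val = 1 then 1
    else if i.val = 3 ^ n ∧ j.val = 3 ^ n - 1 then 1
    else if 0 < i.val ∧ i.val < 3 ^ n ∧ j.val = i.val + 1 then
      (subSeq p (1 - p) n).getD (i.val - 1) 0
    else if 0 < i.val ∧ i.val < 3 ^ n ∧ j.val + 1 = i.val then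
      1 - (subSeq p (1 - p) n).getD (i.val - 1) 0
    else 0

/-- The multiplicity of `z` as an eigenvalue of `Δ_{p,n}`. -/
noncomputable def fracMult (p : ℝ) (n : ℕ) (z : ℝ) : ℕ :=
  Module.finrank ℝ (LinearMap.ker ((fracLap p n - z • (1 : Matrix _ _ ℝ)).mulVecLin))

/-- `z` is an eigenvalue of `Δ_{p,n}`. -/
def fracEig (p : ℝ) (n : ℕ) (z : ℝ) : Prop :=
  LinearMap.ker ((fracLap p n - z • (1 : Matrix _ _ ℝ)).mulVecLin) ≠ ⊥

/-- The sequence obtained from `l` by inserting the pair `p, q` before, between and after its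
entries. -/
def interleavePair (p q : ℝ) : List ℝ → List ℝ
  | [] => [p, q]
  | s :: l => p :: q :: s :: interleavePair p q l

theorem interleavePair_append_cons (p q x : ℝ) (l m : List ℝ) :
    interleavePair p q (l ++ x :: m) = interleavePair p q l ++ x :: interleavePair p q m := by
  induction l with
  | nil => simp [interleavePair]
  | cons s l ih => simp [interleavePair, ih]

theorem subSeq_succ_eq_interleavePair (p q : ℝ) (n : ℕ) :
    subSeq p q (n + 1) = interleavePair p q (subSeq p q n) := by
  induction n with
  | zero => simp [subSeq, interleavePair]
  | succ n ih =>
    rw [subSeq]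
    conv_rhs => rw [subSeq]
    simp [interleavePair_append_cons, ih]

theorem getD_interleavePair_mul_three (p q : ℝ) (l : List ℝ) (k : ℕ) (hk : k ≤ l.length) :
    (interleavePair p q l).getD (3 * k) 0 = p := by
  induction l generalizing k with
  | nil => obtain rfl : k = 0 := by simpa using hk
           simp [interleavePair]
  | cons s l ih =>
    cases k with
    | zero => simp [interleavePair]
    | succ k => simpa [interleavePair, Nat.mul_succ] using ih k (by simpa using hk)

theorem getD_interleavePair_mul_three_add_one (p q : ℝ) (l : List ℝ) (k : ℕ)
    (hk : k ≤ l.length) : (interleavePair p q l).getD (3 * k + 1) 0 = q := by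
  induction l generalizing k with
  | nil => obtain rfl : k = 0 := by simpa using hk
           simp [interleavePair]
  | cons s l ih =>
    cases k with
    | zero => simp [interleavePair]
    | succ k => simpa [interleavePair, Nat.mul_succ] using ih k (by simpa using hk)

theorem getD_interleavePair_mul_three_add_two (p q : ℝ) (l : List ℝ) (k : ℕ) :
    (interleavePair p q l).getD (3 * k + 2) 0 = l.getD k 0 := by
  induction l generalizing k with
  | nil => simp [interleavePair]
  | cons s l ih =>
    cases k with
    | zero => simp [interleavePair]
    | succ k => simpa [interleavePair, Nat.mul_succ] using ih k

theorem length_subSeq_add_one (p q : ℝ) (n : ℕ) : (subSeq p q n).length + 1 = 3 ^ n := by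
  induction n with
  | zero => simp [subSeq]
  | succ n ih => simp only [subSeq, List.length_append, List.length_singleton, pow_succ]; omega

theorem mem_subSeq {p q x : ℝ} {n : ℕ} (hx : x ∈ subSeq p q n) : x = p ∨ x = q := by
  induction n with
  | zero => simp [subSeq] at hx
  | succ n ih =>
    simp only [subSeq, List.mem_append, List.mem_singleton] at hx
    tauto

/-- The probability of stepping right from `i` in the walk on `{0, …, 3ⁿ}` reflected at both
endpoints. -/
noncomputable def stepRight (p : ℝ) (n i : ℕ) : ℝ :=
  if i = 0 then 1 else if i = 3 ^ n then 0 else (subSeq p (1 - p) n).getD (i - 1) 0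

theorem stepRight_zero (p : ℝ) (n : ℕ) : stepRight p n 0 = 1 := by simp [stepRight]

theorem stepRight_last (p : ℝ) (n : ℕ) : stepRight p n (3 ^ n) = 0 := by simp [stepRight]

theorem stepRight_mem_Ioo {p : ℝ} (hp0 : 0 < p) (hp1 : p < 1) {n i : ℕ} (hi0 : 0 < i)
    (hin : i < 3 ^ n) : stepRight p n i ∈ Set.Ioo (0 : ℝ) 1 := by
  have hl := length_subSeq_add_one p (1 - p) n
  have hlt : i - 1 < (subSeq p (1 - p) n).length := by omega
  rw [stepRight, if_neg hi0.ne', if_neg hin.ne, List.getD_eq_getElem _ _ hlt]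
  rcases mem_subSeq (List.getElem_mem hlt) with h | h <;> rw [h] <;> constructor <;> linarith

theorem stepRight_succ_mul_three (p : ℝ) (n k : ℕ) :
    stepRight p (n + 1) (3 * k) = stepRight p n k := by
  rcases k with _ | k
  · simp [stepRight]
  · have h : 3 * (k + 1) - 1 = 3 * k + 2 := by omega
    have h' : 3 * (k + 1) = 3 ^ (n + 1) ↔ k + 1 = 3 ^ n := by rw [pow_succ]; omega
    simp only [stepRight, h', h, subSeq_succ_eq_interleavePair,
      getD_interleavePair_mul_three_add_two]
    simp

theorem stepRight_succ_mul_three_add_one (p : ℝ) {n k : ℕ} (hk : k < 3 ^ n) :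
    stepRight p (n + 1) (3 * k + 1) = p := by
  have hl := length_subSeq_add_one p (1 - p) n
  have h' : ¬ 3 * k + 1 = 3 ^ (n + 1) := by rw [pow_succ]; omega
  rw [stepRight, if_neg (by omega), if_neg h', subSeq_succ_eq_interleavePair, Nat.add_sub_cancel,
    getD_interleavePair_mul_three _ _ _ _ (by omega)]

theorem stepRight_succ_mul_three_add_two (p : ℝ) {n k : ℕ} (hk : k < 3 ^ n) :
    stepRight p (n + 1) (3 * k + 2) = 1 - p := by
  have hl := length_subSeq_add_one p (1 - p) n
  have h' : ¬ 3 * k + 2 = 3 ^ (n + 1) := by rw [pow_succ]; omega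
  rw [stepRight, if_neg (by omega), if_neg h', subSeq_succ_eq_interleavePair,
    show 3 * k + 2 - 1 = 3 * k + 1 by omega,
    getD_interleavePair_mul_three_add_one _ _ _ _ (by omega)]

/-- The Laplacian of the nearest-neighbour walk on `{0, …, N}` stepping right from `i` with
probability `r i` and left with probability `1 - r i`. -/
def walkLap (N : ℕ) (r : ℕ → ℝ) : Matrix (Fin (N + 1)) (Fin (N + 1)) ℝ :=
  Matrix.of fun i j =>
    (if j.val = i.val + 1 then r i else 0) + (if j.val + 1 = i.val then 1 - r i else 0)
      - if j.val = i.val then 1 else 0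

theorem fracLap_eq_walkLap (p : ℝ) (n : ℕ) : fracLap p n = walkLap (3 ^ n) (stepRight p n) := by
  ext i j
  have hN : 0 < 3 ^ n := by positivity
  have hi := i.isLt
  have hj := j.isLt
  simp only [fracLap, walkLap, stepRight, Matrix.of_apply, Fin.ext_iff]
  split_ifs <;> first | omega | simp

/-- `g` satisfies the eigenvalue equation for `z` at each point of `{0, …, N}`. -/
def IsWalkEigen (N : ℕ) (r : ℕ → ℝ) (z : ℝ) (g : ℕ → ℝ) : Prop :=
  ∀ i ≤ N, r i * g (i + 1) + (1 - r i) * g (i - 1) = (1 + z) * g i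

theorem walkLap_mulVec {N : ℕ} {r : ℕ → ℝ} (h0 : r 0 = 1) (hN : r N = 0) (g : ℕ → ℝ)
    (i : Fin (N + 1)) :
    (walkLap N r *ᵥ fun j => g j) i = r i * g (i + 1) + (1 - r i) * g (i - 1) - g i := by
  obtain ⟨i, hi⟩ := i
  simp only [mulVec, dotProduct, walkLap, Matrix.of_apply]
  rw [Fin.sum_univ_eq_sum_range (fun j => ((if j = i + 1 then r i else 0) +
    (if j + 1 = i then 1 - r i else 0) - if j = i then 1 else 0) * g j)]
  simp only [add_mul, sub_mul, Finset.sum_add_distrib, Finset.sum_sub_distrib, ite_mul, zero_mul,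
    one_mul, Finset.sum_ite_eq', Finset.mem_range, hi, if_true]
  have hright : (if i + 1 < N + 1 then r i * g (i + 1) else 0) = r i * g (i + 1) := by
    split_ifs with h
    · rfl
    · obtain rfl : i = N := by omega
      simp [hN]
  rw [hright]
  rcases i with _ | i
  · simp [h0]
  · simp only [add_left_inj, Finset.sum_ite_eq', Finset.mem_range, Nat.add_sub_cancel]
    rw [if_pos (by omega)]

theorem mem_ker_walkLap_sub {N : ℕ} {r : ℕ → ℝ} (h0 : r 0 = 1) (hN : r N = 0) (z : ℝ)
    (g : ℕ → ℝ) :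
    (fun j : Fin (N + 1) => g j) ∈
        LinearMap.ker (walkLap N r - z • (1 : Matrix _ _ ℝ)).mulVecLin ↔
      IsWalkEigen N r z g := by
  rw [LinearMap.mem_ker, mulVecLin_apply, sub_mulVec, smul_mulVec, one_mulVec, funext_iff]
  simp only [Pi.sub_apply, Pi.smul_apply, Pi.zero_apply, walkLap_mulVec h0 hN, smul_eq_mul]
  constructor
  · intro h i hi
    have := h ⟨i, by omega⟩
    dsimp only at this
    linarith
  · intro h i
    have := h i (by omega)
    linarith

theorem exists_nat_extension {N : ℕ} (f : Fin (N + 1) → ℝ) :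
    ∃ g : ℕ → ℝ, (fun j : Fin (N + 1) => g j) = f :=
  ⟨fun k => if h : k < N + 1 then f ⟨k, h⟩ else 0, by
    ext j
    simp only [j.isLt, dif_pos]⟩

theorem IsWalkEigen.eq_zero {N : ℕ} {r : ℕ → ℝ} (hr : ∀ i < N, 0 < r i) {z : ℝ} {g : ℕ → ℝ}
    (hg : IsWalkEigen N r z g) (hg0 : g 0 = 0) : ∀ i ≤ N, g i = 0 := by
  intro i
  induction i using Nat.strong_induction_on with
  | _ i ih =>
    intro hi
    rcases i with _ | i
    · exact hg0
    · have h := hg i (by omega)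
      rw [ih i (by omega) (by omega), ih (i - 1) (by omega) (by omega)] at h
      simpa [(hr i (by omega)).ne'] using h

theorem ker_walkLap_sub_ne_bot_iff {N : ℕ} {r : ℕ → ℝ} (h0 : r 0 = 1) (hN : r N = 0)
    (hr : ∀ i < N, 0 < r i) (z : ℝ) :
    LinearMap.ker (walkLap N r - z • (1 : Matrix _ _ ℝ)).mulVecLin ≠ ⊥ ↔
      ∃ g, IsWalkEigen N r z g ∧ g 0 ≠ 0 := by
  rw [Submodule.ne_bot_iff]
  constructor
  · rintro ⟨f, hf, hne⟩
    obtain ⟨g, rfl⟩ := exists_nat_extension f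
    rw [mem_ker_walkLap_sub h0 hN] at hf
    exact ⟨g, hf, fun hg0 => hne (funext fun j => hf.eq_zero hr hg0 j (by omega))⟩
  · rintro ⟨g, hg, hg0⟩
    exact ⟨_, (mem_ker_walkLap_sub h0 hN z g).2 hg, fun h => hg0 (congrFun h 0)⟩

theorem finrank_ker_walkLap_sub_le_one {N : ℕ} {r : ℕ → ℝ} (h0 : r 0 = 1) (hN : r N = 0)
    (hr : ∀ i < N, 0 < r i) (z : ℝ) :
    Module.finrank ℝ (LinearMap.ker (walkLap N r - z • (1 : Matrix _ _ ℝ)).mulVecLin) ≤ 1 := by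
  refine (LinearMap.finrank_le_finrank_of_injective
    (f := (LinearMap.proj (0 : Fin (N + 1)) : (Fin (N + 1) → ℝ) →ₗ[ℝ] ℝ) ∘ₗ
      Submodule.subtype _) ?_).trans_eq
    (Module.finrank_self ℝ)
  rw [← LinearMap.ker_eq_bot, LinearMap.ker_eq_bot']
  rintro ⟨f, hf⟩ hf0
  obtain ⟨g, rfl⟩ := exists_nat_extension f
  rw [mem_ker_walkLap_sub h0 hN] at hf
  exact Subtype.ext (funext fun j => hf.eq_zero hr hf0 j (by omega))

/-- A reversing measure of the walk with right-step probabilities `r`. -/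
noncomputable def walkWeight (r : ℕ → ℝ) : ℕ → ℝ
  | 0 => 1
  | k + 1 => walkWeight r k * (r k / (1 - r (k + 1)))

theorem walkWeight_pos {N : ℕ} {r : ℕ → ℝ} (hr : ∀ i < N, 0 < r i)
    (hl : ∀ i < N, r (i + 1) < 1) : ∀ k ≤ N, 0 < walkWeight r k := by
  intro k hk
  induction k with
  | zero => exact one_pos
  | succ k ih =>
    exact mul_pos (ih (by omega)) (div_pos (hr k (by omega)) (sub_pos.2 (hl k (by omega))))

theorem walkWeight_mul_walkLap {N : ℕ} {r : ℕ → ℝ} (hl : ∀ i < N, r (i + 1) < 1)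
    (i j : Fin (N + 1)) :
    walkWeight r i * walkLap N r i j = walkWeight r j * walkLap N r j i := by
  have key : ∀ k < N, walkWeight r (k + 1) * (1 - r (k + 1)) = walkWeight r k * r k := by
    intro k hk
    have := sub_pos.2 (hl k hk)
    rw [walkWeight]
    field_simp
  obtain ⟨i, hi⟩ := i
  obtain ⟨j, hj⟩ := j
  simp only [walkLap, Matrix.of_apply]
  rcases lt_trichotomy i j with h | rfl | h
  · by_cases h1 : j = i + 1
    · subst h1
      simp [key i (by omega), show ¬ i + 1 + 1 = i by omega, show ¬ i = i + 1 + 1 by omega]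
    · simp [h1, h.ne, h.ne', show ¬ j + 1 = i by omega, show ¬ i = j + 1 by omega,
        show ¬ i + 1 = j by omega]
  · rfl
  · by_cases h1 : i = j + 1
    · subst h1
      simp [key j (by omega), show ¬ j + 1 + 1 = j by omega, show ¬ j = j + 1 + 1 by omega]
    · simp [h1, h.ne, h.ne', show ¬ j + 1 = i by omega, show ¬ j = i + 1 by omega,
        show ¬ i + 1 = j by omega]

/-- A real matrix that is symmetric with respect to a positive weight and has eigenspaces of
dimension at most one has as many real eigenvalues as rows. -/
theorem exists_finset_eigenvalues_of_symmetrizable {ι : Type*} [Fintype ι] [DecidableEq ι]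
    (A : Matrix ι ι ℝ) (w : ι → ℝ) (hw : ∀ i, 0 < w i)
    (hA : ∀ i j, w i * A i j = w j * A j i)
    (hle : ∀ z : ℝ,
      Module.finrank ℝ (LinearMap.ker (A - z • (1 : Matrix ι ι ℝ)).mulVecLin) ≤ 1) :
    ∃ S : Finset ℝ, S.card = Fintype.card ι ∧
      ∀ z : ℝ, z ∈ S ↔ LinearMap.ker (A - z • (1 : Matrix ι ι ℝ)).mulVecLin ≠ ⊥ := by
  set s : ι → ℝ := fun i => √(w i) with hs
  have hs0 : ∀ i, s i ≠ 0 := fun i => (Real.sqrt_pos.2 (hw i)).ne'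
  have hss : ∀ i, s i * s i = w i := fun i => Real.mul_self_sqrt (hw i).le
  set B : Matrix ι ι ℝ := Matrix.of fun i j => s i * A i j / s j with hBdef
  have hB : B.IsHermitian := by
    ext i j
    simp only [hBdef, conjTranspose_apply, Matrix.of_apply, star_trivial]
    rw [div_eq_div_iff (hs0 i) (hs0 j)]
    linear_combination hA j i + A j i * hss j - A i j * hss i
  have hker : ∀ (z : ℝ) (v : ι → ℝ), B *ᵥ v = z • v →
      (fun i => v i / s i) ∈ LinearMap.ker (A - z • (1 : Matrix ι ι ℝ)).mulVecLin := by
    intro z v hv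
    rw [LinearMap.mem_ker, mulVecLin_apply, sub_mulVec, smul_mulVec, one_mulVec, sub_eq_zero]
    ext i
    have h := congrFun hv i
    simp only [mulVec, dotProduct, hBdef, Matrix.of_apply, Pi.smul_apply, smul_eq_mul] at h ⊢
    rw [← mul_div_assoc, ← h, Finset.sum_div]
    refine Finset.sum_congr rfl fun j _ => ?_
    have := hs0 i
    have := hs0 j
    field_simp
  have hvec : ∀ i, B *ᵥ (hB.eigenvectorBasis i).ofLp =
      hB.eigenvalues i • (hB.eigenvectorBasis i).ofLp := fun i => by
    simpa using hB.mulVec_eigenvectorBasis i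
  have hinj : Function.Injective hB.eigenvalues := by
    intro i j hij
    by_contra hne
    have hi := hker _ _ (hvec i)
    have hj := hker _ _ (hvec j)
    rw [← hij] at hj
    have hlin : LinearIndependent ℝ ![(⟨_, hi⟩ : LinearMap.ker
        (A - hB.eigenvalues i • (1 : Matrix ι ι ℝ)).mulVecLin), ⟨_, hj⟩] := by
      rw [LinearIndependent.pair_iff]
      intro a b hab
      have hcomb : a • hB.eigenvectorBasis i + b • hB.eigenvectorBasis j = 0 := by
        ext k
        have := congrFun (congrArg Subtype.val hab) k
        simp only [Submodule.coe_add, Submodule.coe_smul, Pi.add_apply, Pi.smul_apply,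
          smul_eq_mul, ZeroMemClass.coe_zero, Pi.zero_apply] at this
        have hk := hs0 k
        field_simp at this
        simpa using this
      have hrepr := congrArg hB.eigenvectorBasis.repr hcomb
      have hai := congrArg (fun x => x.ofLp i) hrepr
      have hbj := congrArg (fun x => x.ofLp j) hrepr
      simp [hne, Ne.symm hne] at hai hbj
      exact ⟨hai, hbj⟩
    have htwo := hlin.fintype_card_le_finrank.trans (hle _)
    simp at htwo
  refine ⟨Finset.univ.image hB.eigenvalues, ?_, fun z => ?_⟩
  · rw [Finset.card_image_of_injective _ hinj, Finset.card_univ]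
  · rw [Finset.mem_image, Submodule.ne_bot_iff]
    constructor
    · rintro ⟨i, -, rfl⟩
      refine ⟨_, hker _ _ (hvec i), fun h => ?_⟩
      refine hB.eigenvectorBasis.toBasis.ne_zero i ?_
      ext k
      simpa [hs0 k] using congrFun h k
    · rintro ⟨f, hf, hne⟩
      rw [LinearMap.mem_ker, mulVecLin_apply, sub_mulVec, smul_mulVec, one_mulVec,
        sub_eq_zero] at hf
      have hv : Module.End.HasEigenvector (toLin' B) z (fun i => s i * f i) := by
        refine ⟨Module.End.mem_eigenspace_iff.2 ?_, fun h => hne ?_⟩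
        · rw [toLin'_apply]
          ext i
          have h := congrFun hf i
          simp only [mulVec, dotProduct, hBdef, Matrix.of_apply, Pi.smul_apply,
            smul_eq_mul] at h ⊢
          rw [mul_left_comm, ← h, Finset.mul_sum]
          refine Finset.sum_congr rfl fun j _ => ?_
          have := hs0 j
          field_simp
        · ext i
          simpa [hs0 i] using congrFun h i
      have hz := (Module.End.hasEigenvalue_of_hasEigenvector hv).mem_spectrum
      rw [spectrum_toLin', hB.spectrum_real_eq_range_eigenvalues] at hz
      obtain ⟨i, hi⟩ := hz
      exact ⟨i, Finset.mem_univ i, hi⟩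

theorem IsWalkEigen.decimate {N : ℕ} {r r' : ℕ → ℝ} {p z : ℝ} (hp : p * (1 - p) ≠ 0)
    (h0 : r 0 = 1) (hN : r N = 0) (hr0 : ∀ k ≤ N, r' (3 * k) = r k)
    (hr1 : ∀ k < N, r' (3 * k + 1) = p) (hr2 : ∀ k < N, r' (3 * k + 2) = 1 - p) {g : ℕ → ℝ}
    (hg : IsWalkEigen (3 * N) r' z g) :
    IsWalkEigen N r (z * (z ^ 2 + 3 * z + 2 + p * (1 - p)) / (p * (1 - p)))
      (fun k => g (3 * k)) := by
  have e1 : ∀ k < N, p * g (3 * k + 2) + (1 - p) * g (3 * k) = (1 + z) * g (3 * k + 1) := by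
    intro k hk
    simpa [hr1 k hk] using hg (3 * k + 1) (by omega)
  have e2 : ∀ k < N,
      (1 - p) * g (3 * (k + 1)) + p * g (3 * k + 1) = (1 + z) * g (3 * k + 2) := by
    intro k hk
    simpa [hr2 k hk, Nat.mul_succ] using hg (3 * k + 2) (by omega)
  intro k hk
  have hright : r k * (((1 + z) ^ 2 - p ^ 2) * g (3 * k + 1)) =
      r k * ((1 + z) * (1 - p) * g (3 * k) + p * (1 - p) * g (3 * (k + 1))) := by
    rcases hk.eq_or_lt with rfl | hk
    · simp [hN]
    · linear_combination (-r k) * (1 + z) * e1 k hk - r k * p * e2 k hk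
  have hleft : (1 - r k) * (((1 + z) ^ 2 - p ^ 2) * g (3 * k - 1)) =
      (1 - r k) * ((1 + z) * (1 - p) * g (3 * k) + p * (1 - p) * g (3 * (k - 1))) := by
    rcases k with _ | k
    · simp [h0]
    · rw [Nat.add_sub_cancel, show 3 * (k + 1) - 1 = 3 * k + 2 by omega]
      linear_combination (-(1 - r (k + 1))) * (1 + z) * e2 k hk - (1 - r (k + 1)) * p * e1 k hk
  have hmid := hg (3 * k) (by omega)
  rw [hr0 k hk] at hmid
  refine mul_left_cancel₀ hp ?_
  rw [← mul_assoc _ (1 + _), mul_add _ 1, mul_div_cancel₀ _ hp]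
  linear_combination ((1 + z) ^ 2 - p ^ 2) * hmid - hright - hleft

/-- The extension of `h` from multiples of three which satisfies the eigenvalue equation for `z`
at the remaining points. -/
noncomputable def decimationExtend (p z : ℝ) (h : ℕ → ℝ) (i : ℕ) : ℝ :=
  if i % 3 = 0 then h (i / 3)
  else if i % 3 = 1 then
    ((1 + z) * (1 - p) * h (i / 3) + p * (1 - p) * h (i / 3 + 1)) / ((1 + z) ^ 2 - p ^ 2)
  else
    (p * (1 - p) * h (i / 3) + (1 + z) * (1 - p) * h (i / 3 + 1)) / ((1 + z) ^ 2 - p ^ 2)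

theorem decimationExtend_mul_three (p z : ℝ) (h : ℕ → ℝ) (k : ℕ) :
    decimationExtend p z h (3 * k) = h k := by
  simp [decimationExtend]

theorem decimationExtend_mul_three_add_one (p z : ℝ) (h : ℕ → ℝ) (k : ℕ) :
    decimationExtend p z h (3 * k + 1) =
      ((1 + z) * (1 - p) * h k + p * (1 - p) * h (k + 1)) / ((1 + z) ^ 2 - p ^ 2) := by
  simp [decimationExtend, show (3 * k + 1) / 3 = k by omega, show (3 * k + 1) % 3 = 1 by omega]

theorem decimationExtend_mul_three_add_two (p z : ℝ) (h : ℕ → ℝ) (k : ℕ) :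
    decimationExtend p z h (3 * k + 2) =
      (p * (1 - p) * h k + (1 + z) * (1 - p) * h (k + 1)) / ((1 + z) ^ 2 - p ^ 2) := by
  simp [decimationExtend, show (3 * k + 2) / 3 = k by omega, show (3 * k + 2) % 3 = 2 by omega]

theorem IsWalkEigen.extend {N : ℕ} {r r' : ℕ → ℝ} {p z : ℝ} (hp : p * (1 - p) ≠ 0)
    (hz : (1 + z) ^ 2 - p ^ 2 ≠ 0) (h0 : r 0 = 1) (hr0 : ∀ k ≤ N, r' (3 * k) = r k)
    (hr1 : ∀ k < N, r' (3 * k + 1) = p) (hr2 : ∀ k < N, r' (3 * k + 2) = 1 - p) {h : ℕ → ℝ}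
    (hh : IsWalkEigen N r (z * (z ^ 2 + 3 * z + 2 + p * (1 - p)) / (p * (1 - p))) h) :
    IsWalkEigen (3 * N) r' z (decimationExtend p z h) := by
  intro i hi
  obtain ⟨k, rfl | rfl | rfl⟩ : ∃ k, i = 3 * k ∨ i = 3 * k + 1 ∨ i = 3 * k + 2 :=
    ⟨i / 3, by omega⟩
  · have hk : k ≤ N := by omega
    have hmid := hh k hk
    have hmid' : p * (1 - p) * (r k * h (k + 1) + (1 - r k) * h (k - 1)) =
        (p * (1 - p) + z * (z ^ 2 + 3 * z + 2 + p * (1 - p))) * h k := by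
      rw [hmid, ← mul_assoc, mul_add, mul_div_cancel₀ _ hp, mul_one]
    have hleft : (1 - r k) * decimationExtend p z h (3 * k - 1) = (1 - r k) *
        ((p * (1 - p) * h (k - 1) + (1 + z) * (1 - p) * h k) / ((1 + z) ^ 2 - p ^ 2)) := by
      rcases k with _ | k
      · simp [h0]
      · rw [show 3 * (k + 1) - 1 = 3 * k + 2 by omega, decimationExtend_mul_three_add_two,
          Nat.add_sub_cancel]
    rw [hr0 k hk, hleft, decimationExtend_mul_three_add_one, decimationExtend_mul_three]
    field_simp
    linear_combination hmid'
  · rw [hr1 k (by omega), Nat.add_sub_cancel, decimationExtend_mul_three,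
      decimationExtend_mul_three_add_one, decimationExtend_mul_three_add_two]
    field_simp
    ring
  · rw [hr2 k (by omega), show 3 * k + 2 + 1 = 3 * (k + 1) by ring,
      show 3 * k + 2 - 1 = 3 * k + 1 by omega, decimationExtend_mul_three,
      decimationExtend_mul_three_add_one, decimationExtend_mul_three_add_two]
    field_simp
    ring

theorem stepRight_pos {p : ℝ} (hp0 : 0 < p) (hp1 : p < 1) (n : ℕ) :
    ∀ i < 3 ^ n, 0 < stepRight p n i := by
  intro i hi
  rcases i.eq_zero_or_pos with rfl | h
  · simp [stepRight_zero]
  · exact (stepRight_mem_Ioo hp0 hp1 h hi).1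

theorem stepRight_succ_lt_one {p : ℝ} (hp0 : 0 < p) (hp1 : p < 1) (n : ℕ) :
    ∀ i < 3 ^ n, stepRight p n (i + 1) < 1 := by
  intro i hi
  rcases (Nat.succ_le_of_lt hi).eq_or_lt with h | h
  · rw [← Nat.succ_eq_add_one, h, stepRight_last]
    exact one_pos
  · exact (stepRight_mem_Ioo hp0 hp1 i.succ_pos h).2

theorem fracEig_iff {p : ℝ} (hp0 : 0 < p) (hp1 : p < 1) (n : ℕ) (z : ℝ) :
    fracEig p n z ↔ ∃ g, IsWalkEigen (3 ^ n) (stepRight p n) z g ∧ g 0 ≠ 0 := by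
  rw [fracEig, fracLap_eq_walkLap]
  exact ker_walkLap_sub_ne_bot_iff (stepRight_zero p n) (stepRight_last p n)
    (stepRight_pos hp0 hp1 n) z

theorem fracMult_le_one {p : ℝ} (hp0 : 0 < p) (hp1 : p < 1) (n : ℕ) (z : ℝ) :
    fracMult p n z ≤ 1 := by
  rw [fracMult, fracLap_eq_walkLap]
  exact finrank_ker_walkLap_sub_le_one (stepRight_zero p n) (stepRight_last p n)
    (stepRight_pos hp0 hp1 n) z

theorem fracMult_ne_zero_iff (p : ℝ) (n : ℕ) (z : ℝ) : fracMult p n z ≠ 0 ↔ fracEig p n z := by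
  rw [fracMult, fracEig, Ne, Submodule.finrank_eq_zero]

theorem fracEig_decimation {p : ℝ} (hp0 : 0 < p) (hp1 : p < 1) {z : ℝ} (hz : z ≠ -1 + p)
    (hz' : z ≠ -1 - p) (n : ℕ) :
    fracEig p n (z * (z ^ 2 + 3 * z + 2 + p * (1 - p)) / (p * (1 - p))) ↔
      fracEig p (n + 1) z := by
  have hp : p * (1 - p) ≠ 0 := (mul_pos hp0 (sub_pos.2 hp1)).ne'
  have hD : (1 + z) ^ 2 - p ^ 2 ≠ 0 := by
    rw [sq_sub_sq]
    exact mul_ne_zero (fun h => hz' (by linarith)) (fun h => hz (by linarith))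
  rw [fracEig_iff hp0 hp1, fracEig_iff hp0 hp1, pow_succ' (3 : ℕ) n]
  constructor
  · rintro ⟨h, hh, hh0⟩
    refine ⟨decimationExtend p z h, hh.extend hp hD (stepRight_zero p n)
      (fun k _ => stepRight_succ_mul_three p n k)
      (fun k => stepRight_succ_mul_three_add_one p)
      (fun k => stepRight_succ_mul_three_add_two p), ?_⟩
    simpa [decimationExtend] using hh0
  · rintro ⟨g, hg, hg0⟩
    exact ⟨fun k => g (3 * k), hg.decimate hp (stepRight_zero p n) (stepRight_last p n)
      (fun k _ => stepRight_succ_mul_three p n k)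
      (fun k => stepRight_succ_mul_three_add_one p)
      (fun k => stepRight_succ_mul_three_add_two p), hg0⟩

theorem fracEig_zero_iff {p : ℝ} (hp0 : 0 < p) (hp1 : p < 1) (z : ℝ) :
    fracEig p 0 z ↔ z = 0 ∨ z = -2 := by
  rw [fracEig_iff hp0 hp1]
  constructor
  · rintro ⟨g, hg, hg0⟩
    have e0 := hg 0 (by simp)
    have e1 := hg 1 (by simp)
    simp only [stepRight, pow_zero, if_true, one_ne_zero, if_false] at e0 e1
    norm_num at e0 e1
    have h : g 0 * (z * (z + 2)) = 0 := by linear_combination -e1 - (1 + z) * e0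
    rcases mul_eq_zero.1 ((mul_eq_zero.1 h).resolve_left hg0) with h | h
    · exact Or.inl h
    · exact Or.inr (by linarith)
  · intro h
    refine ⟨fun i => (1 + z) ^ i, fun i hi => ?_, by simp⟩
    obtain rfl | rfl : i = 0 ∨ i = 1 := by rw [pow_zero] at hi; omega
    · simp [stepRight]
    · rcases h with rfl | rfl <;> norm_num [stepRight]

theorem fractal_interval_laplacian_spectral_decimation
    (p : ℝ) (hp0 : 0 < p) (hp1 : p < 1) :
    (∀ z : ℝ, z ≠ -1 + p → z ≠ -1 - p → ∀ n : ℕ,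
      fracMult p n (z * (z ^ 2 + 3 * z + 2 + p * (1 - p)) / (p * (1 - p)))
        = fracMult p (n + 1) z) ∧
    (∀ n : ℕ, ∃ S : Finset ℝ, S.card = 3 ^ n + 1 ∧
      (∀ z : ℝ, z ∈ S ↔ fracEig p n z) ∧ ∀ z ∈ S, fracMult p n z = 1) ∧
    ({z : ℝ | fracEig p 0 z} = {0, -2}) := by
  refine ⟨fun z hz hz' n => ?_, fun n => ?_, ?_⟩
  · have h := fracEig_decimation hp0 hp1 hz hz' n
    rw [← fracMult_ne_zero_iff, ← fracMult_ne_zero_iff] at h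
    have h1 := fracMult_le_one hp0 hp1 n
      (z * (z ^ 2 + 3 * z + 2 + p * (1 - p)) / (p * (1 - p)))
    have h2 := fracMult_le_one hp0 hp1 (n + 1) z
    omega
  · obtain ⟨S, hcard, hS⟩ := exists_finset_eigenvalues_of_symmetrizable (fracLap p n)
      (fun i => walkWeight (stepRight p n) i)
      (fun i => walkWeight_pos (stepRight_pos hp0 hp1 n) (stepRight_succ_lt_one hp0 hp1 n) i
        (by omega))
      (by
        rw [fracLap_eq_walkLap]
        exact walkWeight_mul_walkLap (stepRight_succ_lt_one hp0 hp1 n))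
      (fracMult_le_one hp0 hp1 n)
    refine ⟨S, by rw [hcard, Fintype.card_fin], hS, fun z hz => ?_⟩
    have h := (fracMult_ne_zero_iff p n z).2 ((hS z).1 hz)
    have h1 := fracMult_le_one hp0 hp1 n z
    omega
  · ext z
    exact fracEig_zero_iff hp0 hp1 z
end

section
/- Let c > 1, b > 0, and K ≥ 0 with K·b < 1 − 1/c, and let g : [0,b] → [0,b] be a function satisfying |g(x) − x/c| ≤ K·x² for all x ∈ [0,b]. Then for every x ∈ [0,b] the limit 𝓡(x) := lim_{n→∞} cⁿ·g^{∘n}(x) exists and is finite (where g^{∘n} is the n-fold iterate of g), and 𝓡 satisfies the functional equation 𝓡(x) = c·𝓡(g(x)) for all x ∈ [0,b]. If moreover g is continuous and nondecreasing, then 𝓡 is continuous and nondecreasing on [0,b]. (This is the Fatou-type function 𝓡(z) = lim cⁿ R₁^{-n}(z) attached to the inverse branch of a polynomial R through its repelling fixed point 0 with multiplier c = R'(0).) -/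
open Filter

/-- A nonnegative sequence growing at each step by a factor at most `1 + e * q ^ n` is bounded by
its initial value times `exp (e / (1 - q))`. -/
theorem le_mul_exp_of_succ_le_one_add_geometric_mul {u : ℕ → ℝ} {e q : ℝ} (he : 0 ≤ e)
    (hq : 0 ≤ q) (hq1 : q < 1) (hu : ∀ n, 0 ≤ u n)
    (h : ∀ n, u (n + 1) ≤ (1 + e * q ^ n) * u n) (n : ℕ) :
    u n ≤ u 0 * Real.exp (e / (1 - q)) := by
  have key : ∀ n, u n ≤ u 0 * Real.exp (e * ∑ i ∈ Finset.range n, q ^ i) := by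
    intro n
    induction n with
    | zero => simp
    | succ n ih =>
      calc u (n + 1) ≤ (1 + e * q ^ n) * u n := h n
        _ ≤ Real.exp (e * q ^ n) * (u 0 * Real.exp (e * ∑ i ∈ Finset.range n, q ^ i)) := by
            refine mul_le_mul ?_ ih (hu n) (Real.exp_pos _).le
            linarith [Real.add_one_le_exp (e * q ^ n)]
        _ = u 0 * Real.exp (e * ∑ i ∈ Finset.range (n + 1), q ^ i) := by
            rw [Finset.sum_range_succ, mul_add, Real.exp_add]
            ring
  refine (key n).trans (mul_le_mul_of_nonneg_left (Real.exp_le_exp.mpr ?_) (hu 0))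
  rw [div_eq_mul_inv, ← tsum_geometric_of_lt_one hq hq1]
  exact mul_le_mul_of_nonneg_left
    ((summable_geometric_of_lt_one hq hq1).sum_le_tsum _ fun i _ => pow_nonneg hq i) he

/-- The rescaled iterates `c ^ n * g^[n] x` have geometrically small increments, uniformly on
`[0, b]`. -/
theorem exists_dist_rescaled_iterate_le_geometric
    {c b K : ℝ} (hc : 1 < c) (hb : 0 < b) (hK : 0 ≤ K) (hKb : K * b < 1 - 1 / c)
    {g : ℝ → ℝ} (hmap : ∀ x ∈ Set.Icc 0 b, g x ∈ Set.Icc 0 b)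
    (happrox : ∀ x ∈ Set.Icc 0 b, |g x - x / c| ≤ K * x ^ 2) :
    ∃ C q : ℝ, 0 ≤ q ∧ q < 1 ∧ ∀ x ∈ Set.Icc 0 b, ∀ n : ℕ,
      dist (c ^ n * g^[n] x) (c ^ (n + 1) * g^[n + 1] x) ≤ C * q ^ n := by
  have hc0 : 0 < c := by linarith
  have he : 0 ≤ c * K * b := by positivity
  obtain ⟨q, hq⟩ : ∃ q, q = 1 / c + K * b := ⟨_, rfl⟩
  have hq0 : 0 ≤ q := by rw [hq]; positivity
  have hq1 : q < 1 := by rw [hq]; linarith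
  refine ⟨c * K * b * (b * Real.exp (c * K * b / (1 - q))), q, hq0, hq1, fun x hx => ?_⟩
  have hit : ∀ n, g^[n] x ∈ Set.Icc 0 b := fun n => Set.MapsTo.iterate hmap n hx
  have hdecay : ∀ n, g^[n] x ≤ b * q ^ n := by
    intro n
    induction n with
    | zero => simpa using hx.2
    | succ n ih =>
      obtain ⟨h0, hle⟩ := hit n
      rw [Function.iterate_succ_apply']
      have h1 := (abs_le.mp (happrox _ (hit n))).2
      have h2 : K * (g^[n] x) ^ 2 ≤ K * b * g^[n] x := by
        nlinarith [mul_nonneg (mul_nonneg hK h0) (sub_nonneg.mpr hle)]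
      calc g (g^[n] x) ≤ g^[n] x / c + K * b * g^[n] x := by linarith
        _ = q * g^[n] x := by rw [hq]; ring
        _ ≤ q * (b * q ^ n) := mul_le_mul_of_nonneg_left ih hq0
        _ = b * q ^ (n + 1) := by ring
  have hu : ∀ n, 0 ≤ c ^ n * g^[n] x := fun n => mul_nonneg (by positivity) (hit n).1
  have hstep : ∀ n, |c ^ (n + 1) * g^[n + 1] x - c ^ n * g^[n] x|
      ≤ c * K * b * q ^ n * (c ^ n * g^[n] x) := by
    intro n
    have h1 : c ^ (n + 1) * g^[n + 1] x - c ^ n * g^[n] x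
        = c ^ (n + 1) * (g (g^[n] x) - g^[n] x / c) := by
      rw [Function.iterate_succ_apply']
      field_simp
      ring
    rw [h1, abs_mul, abs_of_pos (by positivity : 0 < c ^ (n + 1))]
    calc c ^ (n + 1) * |g (g^[n] x) - g^[n] x / c|
        ≤ c ^ (n + 1) * (K * (g^[n] x) ^ 2) :=
          mul_le_mul_of_nonneg_left (happrox _ (hit n)) (by positivity)
      _ = c * K * (c ^ n * g^[n] x) * g^[n] x := by ring
      _ ≤ c * K * (c ^ n * g^[n] x) * (b * q ^ n) :=
          mul_le_mul_of_nonneg_left (hdecay n) (mul_nonneg (by positivity) (hu n))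
      _ = c * K * b * q ^ n * (c ^ n * g^[n] x) := by ring
  have hbound : ∀ n, c ^ n * g^[n] x ≤ b * Real.exp (c * K * b / (1 - q)) := by
    intro n
    refine (le_mul_exp_of_succ_le_one_add_geometric_mul (u := fun n => c ^ n * g^[n] x)
      he hq0 hq1 hu (fun n => ?_) n).trans ?_
    · linarith [(abs_le.mp (hstep n)).2]
    · simpa using mul_le_mul_of_nonneg_right hx.2 (Real.exp_pos _).le
  intro n
  rw [dist_comm, Real.dist_eq]
  calc _ ≤ c * K * b * q ^ n * (c ^ n * g^[n] x) := hstep n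
    _ ≤ c * K * b * q ^ n * (b * Real.exp (c * K * b / (1 - q))) :=
        mul_le_mul_of_nonneg_left (hbound n) (by positivity)
    _ = _ := by ring

theorem MonotoneOn.iterate_of_mapsTo {α : Type*} [Preorder α] {f : α → α} {s : Set α}
    (hf : MonotoneOn f s) (hs : Set.MapsTo f s s) (n : ℕ) : MonotoneOn f^[n] s := by
  induction n with
  | zero => exact monotoneOn_id
  | succ n ih => exact ih.comp hf hs

theorem fatou_function_exists
    (c b K : ℝ) (hc : 1 < c) (hb : 0 < b) (hK : 0 ≤ K) (hKb : K * b < 1 - 1 / c)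
    (g : ℝ → ℝ) (hmap : ∀ x ∈ Set.Icc 0 b, g x ∈ Set.Icc 0 b)
    (happrox : ∀ x ∈ Set.Icc 0 b, |g x - x / c| ≤ K * x ^ 2) :
    ∃ R : ℝ → ℝ,
      (∀ x ∈ Set.Icc 0 b,
        Filter.Tendsto (fun n => c ^ n * g^[n] x) Filter.atTop (nhds (R x))) ∧
      (∀ x ∈ Set.Icc 0 b, R x = c * R (g x)) ∧
      ((ContinuousOn g (Set.Icc 0 b) ∧ MonotoneOn g (Set.Icc 0 b)) →
        ContinuousOn R (Set.Icc 0 b) ∧ MonotoneOn R (Set.Icc 0 b)) := by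
  obtain ⟨C, q, hq0, hq1, hdist⟩ :=
    exists_dist_rescaled_iterate_le_geometric hc hb hK hKb hmap happrox
  have hlim : ∀ x ∈ Set.Icc 0 b, Tendsto (fun n => c ^ n * g^[n] x) atTop
      (nhds (limUnder atTop fun n => c ^ n * g^[n] x)) := fun x hx =>
    (cauchySeq_of_le_geometric q C hq1 (hdist x hx)).tendsto_limUnder
  refine ⟨fun x => limUnder atTop fun n => c ^ n * g^[n] x, hlim, fun x hx => ?_, ?_⟩
  · refine tendsto_nhds_unique ((tendsto_add_atTop_iff_nat 1).mpr (hlim x hx)) ?_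
    refine ((hlim (g x) (hmap x hx)).const_mul c).congr fun n => ?_
    rw [Function.iterate_succ_apply]
    ring
  · rintro ⟨hcont, hmono⟩
    constructor
    · have hunif : TendstoUniformlyOn (fun n x => c ^ n * g^[n] x)
          (fun x => limUnder atTop fun n => c ^ n * g^[n] x) atTop (Set.Icc 0 b) := by
        rw [Metric.tendstoUniformlyOn_iff]
        intro ε hε
        have h0 : Tendsto (fun n : ℕ => C * q ^ n / (1 - q)) atTop (nhds 0) := by
          simpa using ((tendsto_pow_atTop_nhds_zero_of_lt_one hq0 hq1).const_mul C).div_const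
            (1 - q)
        filter_upwards [h0.eventually_lt_const hε] with n hn x hx
        rw [dist_comm]
        exact (dist_le_of_le_geometric_of_tendsto q C hq1 (hdist x hx) (hlim x hx) n).trans_lt hn
      exact hunif.continuousOn
        (Frequently.of_forall fun n => (hcont.iterate hmap n).const_mul (c ^ n))
    · intro x hx y hy hxy
      refine le_of_tendsto_of_tendsto' (hlim x hx) (hlim y hy) fun n => ?_
      exact mul_le_mul_of_nonneg_left (hmono.iterate_of_mapsTo hmap n hx hy hxy)
        (pow_nonneg (by linarith) n)
end

section
/- Fix 0 < p < 1 and set q = 1 − p. Define resistance weights r₁ = r₃ = (p + pq)/(2 + pq) and r₂ = (2q − pq)/(2 + pq), and contractions F_{p,j}(x) = r_j·x + (1 − r_j)·x_j with fixed points x₁ = 0, x₂ = 1/2, x₃ = 1, so that F_{p,1}([0,1]), F_{p,2}([0,1]), F_{p,3}([0,1]) cover [0,1]. Define discrete energies recursively by E_{p,0}(f) := (f(1) − f(0))² and E_{p,n}(f) := Σ_{j=1}^{3} (1/r_j) · E_{p,n−1}(f ∘ F_{p,j}) for f : [0,1] → ℝ. Then E_{p,n+1}(f) ≥ E_{p,n}(f)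 for every function f : [0,1] → ℝ and every n ∈ ℕ. -/
open Finset

/-- The resistance weights `r₁ = r₃ = (p + pq)/(2 + pq)`, `r₂ = (2q − pq)/(2 + pq)`,
with `q = 1 − p`. -/
noncomputable def resWeight (p : ℝ) : Fin 3 → ℝ :=
  ![(p + p * (1 - p)) / (2 + p * (1 - p)),
    (2 * (1 - p) - p * (1 - p)) / (2 + p * (1 - p)),
    (p + p * (1 - p)) / (2 + p * (1 - p))]

/-- The fixed points `x₁ = 0`, `x₂ = 1/2`, `x₃ = 1`. -/
noncomputable def fixPt : Fin 3 → ℝ := ![0, 1 / 2, 1]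

/-- The contractions `F_{p,j}(x) = r_j·x + (1 − r_j)·x_j`. -/
noncomputable def contrF (p : ℝ) (j : Fin 3) (x : ℝ) : ℝ :=
  resWeight p j * x + (1 - resWeight p j) * fixPt j

/-- The discrete energies `E_{p,0}(f) = (f(1) − f(0))²`,
`E_{p,n+1}(f) = Σ_{j} (1/r_j)·E_{p,n}(f ∘ F_{p,j})`. -/
noncomputable def pEnergy (p : ℝ) : ℕ → (ℝ → ℝ) → ℝ
  | 0, f => (f 1 - f 0) ^ 2
  | n + 1, f => ∑ j : Fin 3, (1 / resWeight p j) * pEnergy p n (f ∘ contrF p j)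

lemma resWeight_pos {p : ℝ} (hp0 : 0 < p) (hp1 : p < 1) (j : Fin 3) : 0 < resWeight p j := by
  have hq : 0 < 1 - p := sub_pos.2 hp1
  have hpq : 0 < p * (1 - p) := mul_pos hp0 hq
  have hr₂ : 0 < 2 * (1 - p) - p * (1 - p) := by nlinarith
  fin_cases j <;> simp [resWeight] <;> positivity

lemma sum_resWeight {p : ℝ} (hp0 : 0 < p) (hp1 : p < 1) : ∑ j, resWeight p j = 1 := by
  have hpq : 0 < p * (1 - p) := mul_pos hp0 (sub_pos.2 hp1)
  have hd : 2 + p * (1 - p) ≠ 0 := by positivity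
  simp only [resWeight, Fin.sum_univ_three, Matrix.cons_val]
  field_simp
  ring

/-- The cells tile `[0,1]`, so the increments of `f` over the cells telescope. -/
lemma sum_increments_contrF {p : ℝ} (hp0 : 0 < p) (hp1 : p < 1) (f : ℝ → ℝ) :
    ∑ j, (f (contrF p j 1) - f (contrF p j 0)) = f 1 - f 0 := by
  have hsum := sum_resWeight hp0 hp1
  have hsymm : resWeight p 2 = resWeight p 0 := rfl
  rw [Fin.sum_univ_three] at hsum
  have h₀ : contrF p 0 0 = 0 := by simp [contrF, fixPt]
  have h₁ : contrF p 1 0 = contrF p 0 1 := by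
    simp only [contrF, fixPt, Matrix.cons_val]
    linarith
  have h₂ : contrF p 2 0 = contrF p 1 1 := by
    simp only [contrF, fixPt, Matrix.cons_val]
    linarith
  have h₃ : contrF p 2 1 = 1 := by simp [contrF, fixPt]
  rw [Fin.sum_univ_three, h₀, h₁, h₂, h₃]
  ring

theorem pEnergy_monotone (p : ℝ) (hp0 : 0 < p) (hp1 : p < 1) :
    ∀ (f : ℝ → ℝ) (n : ℕ), pEnergy p n f ≤ pEnergy p (n + 1) f := by
  intro f n
  induction n generalizing f with
  | zero =>
    have h := Finset.sq_sum_div_le_sum_sq_div univ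
      (fun j => f (contrF p j 1) - f (contrF p j 0)) (fun j _ => resWeight_pos hp0 hp1 j)
    rw [sum_resWeight hp0 hp1, sum_increments_contrF hp0 hp1, div_one] at h
    simpa only [pEnergy, Function.comp_apply, one_div_mul_eq_div] using h
  | succ n ih =>
    rw [pEnergy, pEnergy]
    exact sum_le_sum fun j _ =>
      mul_le_mul_of_nonneg_left (ih _) (one_div_nonneg.2 (resWeight_pos hp0 hp1 j).le)
end

section
/- Let v₁ = (0,0), v₂ = (1,0), v₃ = (1/2, √3/2) in ℝ², let F_j(x) = (x + v_j)/2 for j = 1,2,3, and define V₀ = {v₁, v₂, v₃} and, for a word w = (w₁,…,w_n) ∈ {1,2,3}ⁿ, the cell F_w(V₀) = F_{w₁}∘⋯∘F_{w_n}(V₀). For n ∈ ℕ and f : ℝ² → ℝ define the discrete Sierpiński gasket energy E_n(f) := (5/3)ⁿ · Σ (f(x) − f(y))², where the sum is over all unordered pairs {x,y} of distinct points such that x and y both belong to F_w(V₀) for some word w ∈ {1,2,3}ⁿ, each such pair counted once. Then E_{n+1}(f) ≥ E_n(f) for every f : ℝ² → ℝ and every n ∈ ℕ. -/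
open Finset

/-- The three corners `v₁ = (0,0)`, `v₂ = (1,0)`, `v₃ = (1/2, √3/2)` of the Sierpiński
gasket. -/
noncomputable def gasketV : Fin 3 → ℝ × ℝ := ![(0, 0), (1, 0), (1 / 2, Real.sqrt 3 / 2)]

/-- The contractions `F_j(x) = (x + v_j)/2`. -/
noncomputable def gasketF (j : Fin 3) (x : ℝ × ℝ) : ℝ × ℝ :=
  ((x.1 + (gasketV j).1) / 2, (x.2 + (gasketV j).2) / 2)

/-- The map `F_{w₁} ∘ ⋯ ∘ F_{w_n}` of a word `w = (w₁, …, w_n)`. -/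
noncomputable def gasketWordMap (l : List (Fin 3)) : ℝ × ℝ → ℝ × ℝ :=
  l.foldr (fun j g => gasketF j ∘ g) id

/-- The discrete Sierpiński gasket energy
`E_n(f) = (5/3)ⁿ · Σ (f(x) − f(y))²` over unordered pairs `{x, y}` of distinct points lying
in a common level-`n` cell `F_w(V₀)`, each counted once; since distinct level-`n` cells
share at most one point and each cell has three distinct vertices, this equals the sum over
words `w ∈ {1,2,3}ⁿ` of the energies of the three edges of the cell `F_w(V₀)`. -/
noncomputable def gasketEnergy (n : ℕ) (f : ℝ × ℝ → ℝ) : ℝ :=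
  (5 / 3) ^ n * ∑ w : Fin n → Fin 3,
    ((f (gasketWordMap (List.ofFn w) (gasketV 0)) -
        f (gasketWordMap (List.ofFn w) (gasketV 1))) ^ 2 +
      (f (gasketWordMap (List.ofFn w) (gasketV 0)) -
        f (gasketWordMap (List.ofFn w) (gasketV 2))) ^ 2 +
      (f (gasketWordMap (List.ofFn w) (gasketV 1)) -
        f (gasketWordMap (List.ofFn w) (gasketV 2))) ^ 2)

theorem gasketEnergy_succ (n : ℕ) (f : ℝ × ℝ → ℝ) :
    gasketEnergy (n + 1) f = 5 / 3 * ∑ j, gasketEnergy n (f ∘ gasketF j) := by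
  simp only [gasketEnergy]
  rw [← (Fin.consEquiv fun _ => Fin 3).sum_comp, Fintype.sum_prod_type, ← Finset.mul_sum,
    ← mul_assoc, ← pow_succ']
  simp [Fin.consEquiv, List.ofFn_succ, gasketWordMap]

/-- Equality holds at the harmonic extension `x = (2a + 2b + c)/5`, and similarly for `y`, `z`. -/
theorem triangle_energy_le (a b c x y z : ℝ) :
    (a - b) ^ 2 + (a - c) ^ 2 + (b - c) ^ 2 ≤
      5 / 3 * (((a - x) ^ 2 + (a - y) ^ 2 + (x - y) ^ 2) +
        ((x - b) ^ 2 + (x - z) ^ 2 + (b - z) ^ 2) +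
        ((y - z) ^ 2 + (y - c) ^ 2 + (z - c) ^ 2)) := by
  set u := x - (2 * a + 2 * b + c) / 5 with hu
  set v := y - (2 * a + b + 2 * c) / 5 with hv
  set w := z - (a + 2 * b + 2 * c) / 5 with hw
  have hx : x = u + (2 * a + 2 * b + c) / 5 := by rw [hu]; ring
  have hy : y = v + (2 * a + b + 2 * c) / 5 := by rw [hv]; ring
  have hz : z = w + (a + 2 * b + 2 * c) / 5 := by rw [hw]; ring
  clear_value u v w
  subst hx hy hz
  linarith [sq_nonneg u, sq_nonneg v, sq_nonneg w, sq_nonneg (u - v), sq_nonneg (u - w),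
    sq_nonneg (v - w)]

theorem gasketF_gasketV_self (j : Fin 3) : gasketF j (gasketV j) = gasketV j := by
  ext <;> simp [gasketF]

theorem gasketF_gasketV_comm (i j : Fin 3) :
    gasketF i (gasketV j) = gasketF j (gasketV i) := by
  ext <;> simp [gasketF, add_comm]

theorem gasketEnergy_zero_le_one (f : ℝ × ℝ → ℝ) : gasketEnergy 0 f ≤ gasketEnergy 1 f := by
  rw [gasketEnergy_succ]
  simp only [gasketEnergy, Fin.sum_univ_three, pow_zero, one_mul, Finset.univ_unique,
    Finset.sum_singleton, List.ofFn_zero, gasketWordMap, List.foldr_nil, id, Function.comp_apply,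
    gasketF_gasketV_self, gasketF_gasketV_comm 1 0, gasketF_gasketV_comm 2 0,
    gasketF_gasketV_comm 2 1]
  exact triangle_energy_le _ _ _ _ _ _

theorem gasket_energy_monotone :
    ∀ (f : ℝ × ℝ → ℝ) (n : ℕ), gasketEnergy n f ≤ gasketEnergy (n + 1) f := by
  intro f n
  induction n generalizing f with
  | zero => exact gasketEnergy_zero_le_one f
  | succ n ih =>
    rw [gasketEnergy_succ n, gasketEnergy_succ (n + 1)]
    gcongr
    exact ih _
end
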